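/- arXiv:1110.3110 — 3 statements merged into one kernel-verified Lean document; each statement's English description precedes it below -/
import Mathlib

section
/- Let 0 < R < ∞ and let ρ be a nonconstant meromorphic function on the disk Δ_R = {z ∈ ℂ : |z| < R}. Let q be a positive integer, let α₁, …, α_{q−1} ∈ ℂ be distinct and set α_q = ∞, and let m₁, …, m_q be positive integers with γ := ∑_{j=1}^{q} (1 − 1/m_j) > 2. Suppose every zero of ρ − α_j has multiplicity at least m_j for j ≤ q−1, and every pole of ρ has multiplicity at least m_q. Then for all real numbers η ≥ 0 and δ > 0 with γ − 2 > γ(η + δ) there exists a constant C > 0, depending only on γ, η, δ, and L := min_{i<j} |α_i, α_j|, such that for every z ∈ Δ_R which is not a pole of ρ: (|ρ'(z)|/(1 + |ρ(z)|²)) · ∏_{j=1}^{q} |ρ(z), α_j|^{−(1−1/m_j)(1−η−δ)} ≤ C·R/(R² − |z|²). -/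
/-- Half the chordal distance: `|α, β| = |α - β| / (√(1+|α|²)·√(1+|β|²))`. -/
noncomputable def chordal (a b : ℂ) : ℝ :=
  ‖a - b‖ / (Real.sqrt (1 + ‖a‖ ^ 2) * Real.sqrt (1 + ‖b‖ ^ 2))

/-- `|α, ∞| = 1 / √(1+|α|²)`. -/
noncomputable def chordalInf (a : ℂ) : ℝ := 1 / Real.sqrt (1 + ‖a‖ ^ 2)


open Filter Topology Asymptotics in
lemma fuj_taylor2 {𝕜 : Type*} [RCLike 𝕜] {f : 𝕜 → 𝕜} {p : 𝕜} (hf : AnalyticAt 𝕜 f p) :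
    (fun w => f (p + w) - (f p + deriv f p * w + iteratedDeriv 2 f p / 2 * w ^ 2))
      =o[𝓝 0] (fun w => w ^ 2) := by
  have h0 : AnalyticAt 𝕜 (fun w => f (p + w)) 0 := by
    have : AnalyticAt 𝕜 f (p + 0) := by simpa using hf
    exact AnalyticAt.fun_comp (g := f) (f := fun w => p + w) this (by fun_prop)
  obtain ⟨F, hF, hE⟩ := h0.exists_eventuallyEq_sum_add_pow_mul 3
  have e1 : iteratedDeriv 1 (fun w => f (p + w)) 0 = deriv f p := by
    rw [iteratedDeriv_comp_const_add]; simp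
  have e2 : iteratedDeriv 2 (fun w => f (p + w)) 0 = iteratedDeriv 2 f p := by
    rw [iteratedDeriv_comp_const_add]; simp
  have h3 : (fun w : 𝕜 => w ^ 2 * (w * F w)) =o[𝓝 0] (fun w => w ^ 2 * (1:𝕜)) := by
    refine (isBigO_refl _ _).mul_isLittleO ?_
    rw [isLittleO_one_iff]
    have : ContinuousAt (fun w => w * F w) 0 := continuousAt_id.mul hF.continuousAt
    simpa [ContinuousAt] using this
  simp only [mul_one] at h3
  refine h3.congr' ?_ (EventuallyEq.refl _ _)
  filter_upwards [hE] with w hw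
  rw [hw]
  simp only [Finset.sum_range_succ, Finset.sum_range_zero, e1, e2, iteratedDeriv_zero]
  simp [Nat.factorial]
  ring

/-- Second order Peano expansion with gradient data `G` and Laplacian `Lam`. -/
def FujLap (v : ℂ → ℝ) (p G : ℂ) (Lam : ℝ) : Prop :=
  ∃ H : ℂ, (fun w : ℂ => v (p + w) - (v p + (G * w).re + (H * w ^ 2).re + Lam / 4 * ‖w‖ ^ 2))
    =o[nhds 0] (fun w : ℂ => ‖w‖ ^ 2)

namespace FujLap
open Filter Topology Asymptotics

variable {v v' : ℂ → ℝ} {p G G' : ℂ} {a a' : ℝ}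

lemma congr_data (h : FujLap v p G a) (hG : G = G') (ha : a = a') : FujLap v p G' a' := by
  subst hG; subst ha; exact h

lemma add (h : FujLap v p G a) (h' : FujLap v' p G' a') :
    FujLap (fun z => v z + v' z) p (G + G') (a + a') := by
  obtain ⟨H, hH⟩ := h
  obtain ⟨H', hH'⟩ := h'
  refine ⟨H + H', (hH.add hH').congr_left fun w => ?_⟩
  simp only [add_mul, Complex.add_re]
  ring

lemma const_mul (c : ℝ) (h : FujLap v p G a) :
    FujLap (fun z => c * v z) p (c * G) (c * a) := by
  obtain ⟨H, hH⟩ := h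
  refine ⟨c * H, (hH.const_mul_left c).congr_left fun w => ?_⟩
  simp only [mul_assoc, Complex.re_ofReal_mul]
  ring

lemma const (c : ℝ) : FujLap (fun _ => c) p 0 0 := ⟨0, by simp⟩

lemma sum {ι : Type*} (s : Finset ι) (v : ι → ℂ → ℝ) (G : ι → ℂ) (a : ι → ℝ)
    (h : ∀ i ∈ s, FujLap (v i) p (G i) (a i)) :
    FujLap (fun z => ∑ i ∈ s, v i z) p (∑ i ∈ s, G i) (∑ i ∈ s, a i) := by
  classical
  induction s using Finset.induction_on with
  | empty => simpa using const 0
  | insert i s hi ih =>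
    simp only [Finset.sum_insert hi]
    exact (h i (by simp)).add (ih fun j hj => h j (by simp [hj]))

lemma re {f : ℂ → ℂ} (hf : AnalyticAt ℂ f p) : FujLap (fun z => (f z).re) p (deriv f p) 0 := by
  refine ⟨iteratedDeriv 2 f p / 2, ?_⟩
  have h := (fuj_taylor2 hf).norm_right
  simp only [norm_pow] at h
  refine IsBigO.trans_isLittleO ?_ h
  refine IsBigO.of_bound 1 (Eventually.of_forall fun w => ?_)
  rw [one_mul]
  refine le_trans (le_of_eq ?_) (Complex.abs_re_le_norm _)
  rw [Real.norm_eq_abs]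
  congr 1
  simp

lemma comp {φ : ℝ → ℝ} (hv : FujLap v p G a) (hφ : AnalyticAt ℝ φ (v p)) :
    FujLap (fun z => φ (v z)) p (deriv φ (v p) * G)
      (deriv φ (v p) * a + iteratedDeriv 2 φ (v p) * ‖G‖ ^ 2) := by
  obtain ⟨H, hH⟩ := hv
  set φ1 := deriv φ (v p) with hφ1
  set φ2 := iteratedDeriv 2 φ (v p) with hφ2
  have hT := fuj_taylor2 hφ
  rw [← hφ1, ← hφ2] at hT
  set q : ℂ → ℝ := fun w => v (p + w) - v p with hq
  have hw2 : (fun w : ℂ => ‖w‖ ^ 2) =o[𝓝 0] (fun w : ℂ => ‖w‖) := by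
    have : (fun w : ℂ => ‖w‖ * ‖w‖) =o[𝓝 0] (fun w : ℂ => (1:ℝ) * ‖w‖) := by
      refine IsLittleO.mul_isBigO ?_ (isBigO_refl _ _)
      rw [isLittleO_one_iff]
      exact tendsto_norm_zero
    simpa [sq] using this
  have hquad : (fun w => q w - (G * w).re) =O[𝓝 0] (fun w : ℂ => ‖w‖ ^ 2) := by
    have h2 : (fun w : ℂ => (H * w ^ 2).re + a / 4 * ‖w‖ ^ 2) =O[𝓝 0] (fun w : ℂ => ‖w‖ ^ 2) := by
      refine IsBigO.add ?_ (isBigO_const_mul_self _ _ _)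
      refine IsBigO.of_bound ‖H‖ (Eventually.of_forall fun w => ?_)
      refine (Complex.abs_re_le_norm _).trans ?_
      simp
    refine (hH.isBigO.add h2).congr_left fun w => ?_
    simp only [hq]; ring
  have hlin : (fun w : ℂ => (G * w).re) =O[𝓝 0] (fun w : ℂ => ‖w‖) := by
    refine IsBigO.of_bound ‖G‖ (Eventually.of_forall fun w => ?_)
    refine (Complex.abs_re_le_norm _).trans ?_
    simp
  have hqO : q =O[𝓝 0] (fun w : ℂ => ‖w‖) := by
    refine ((hquad.trans_isLittleO hw2).isBigO.add hlin).congr_left fun w => ?_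
    ring
  have hq0 : Tendsto q (𝓝 0) (𝓝 0) := by
    refine hqO.trans_tendsto ?_
    exact tendsto_norm_zero
  have h1 : (fun w => φ (v p + q w) - (φ (v p) + φ1 * q w + φ2 / 2 * q w ^ 2)) =o[𝓝 0]
      (fun w : ℂ => ‖w‖ ^ 2) :=
    (hT.comp_tendsto hq0).trans_isBigO (hqO.pow 2)
  have h2 : (fun w => q w ^ 2 - (G * w).re ^ 2) =o[𝓝 0] (fun w : ℂ => ‖w‖ ^ 2) := by
    have : (fun w => (q w - (G * w).re) * (q w + (G * w).re)) =o[𝓝 0]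
        (fun w : ℂ => ‖w‖ * ‖w‖) :=
      (hquad.trans_isLittleO hw2).mul_isBigO (hqO.add hlin)
    refine (this.congr_left fun w => ?_).congr_right fun w => ?_
    · ring
    · ring
  refine ⟨φ1 * H + φ2 / 4 * G ^ 2, ?_⟩
  refine ((h1.add (h2.const_mul_left (φ2 / 2))).add (hH.const_mul_left φ1)).congr_left fun w => ?_
  have e : v p + q w = v (p + w) := by simp [hq]
  have e2 : (G * w).re ^ 2 = ((G ^ 2 * w ^ 2).re + ‖G‖ ^ 2 * ‖w‖ ^ 2) / 2 := by
    rw [← Complex.normSq_eq_norm_sq, ← Complex.normSq_eq_norm_sq]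
    simp [Complex.normSq_apply, pow_two]
    ring
  have e3 : (((φ1:ℂ) * H + φ2 / 4 * G ^ 2) * w ^ 2).re
      = φ1 * (H * w ^ 2).re + φ2 / 4 * (G ^ 2 * w ^ 2).re := by
    have : (((φ1:ℂ) * H + φ2 / 4 * G ^ 2) * w ^ 2)
      = (φ1 : ℂ) * (H * w ^ 2) + ((φ2 / 4 : ℝ) : ℂ) * (G ^ 2 * w ^ 2) := by
      push_cast; ring
    rw [this, Complex.add_re, Complex.re_ofReal_mul, Complex.re_ofReal_mul]
  have e4 : ((φ1:ℂ) * G * w).re = φ1 * (G * w).re := by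
    rw [mul_assoc, Complex.re_ofReal_mul]
  rw [e3, e4, e, e2]
  simp only [hq]
  ring

lemma log (hv : FujLap v p G a) (h0 : 0 < v p) :
    FujLap (fun z => Real.log (v z)) p ((v p : ℂ)⁻¹ * G) (a / v p - ‖G‖ ^ 2 / v p ^ 2) := by
  have := hv.comp (φ := Real.log) (analyticAt_log h0)
  refine this.congr_data ?_ ?_
  · simp
  · have : iteratedDeriv 2 Real.log (v p) = -(v p ^ 2)⁻¹ := by
      rw [iteratedDeriv_succ, iteratedDeriv_one, Real.deriv_log']
      simp
    rw [this]; simp; ring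

lemma exp (hv : FujLap v p G a) :
    FujLap (fun z => Real.exp (v z)) p (Real.exp (v p) * G)
      (Real.exp (v p) * (a + ‖G‖ ^ 2)) := by
  have := hv.comp (φ := Real.exp) analyticAt_rexp
  refine this.congr_data ?_ ?_
  · simp
  · simp [iteratedDeriv_eq_iterate]; ring

lemma sq (hv : FujLap v p G a) :
    FujLap (fun z => v z ^ 2) p (2 * v p * G) (2 * v p * a + 2 * ‖G‖ ^ 2) := by
  have := hv.comp (φ := fun x => x ^ 2) (by fun_prop)
  refine this.congr_data ?_ ?_
  · simp
  · have : iteratedDeriv 2 (fun x : ℝ => x ^ 2) (v p) = 2 := by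
      have hd : deriv (fun x : ℝ => x ^ 2) = fun x => 2 * x := by
        funext x; simp
      rw [iteratedDeriv_succ, iteratedDeriv_one, hd]
      simp
    rw [this]; simp

lemma norm_sq {f : ℂ → ℂ} (hf : AnalyticAt ℂ f p) :
    FujLap (fun z => ‖f z‖ ^ 2) p (2 * (starRingEnd ℂ (f p) * deriv f p))
      (4 * ‖deriv f p‖ ^ 2) := by
  have h1 := (re hf).sq
  have hI : AnalyticAt ℂ (fun z => -Complex.I * f z) p := by fun_prop
  have h2 := (re hI).sq
  have h := h1.add h2
  have hd : deriv (fun z => -Complex.I * f z) p = -Complex.I * deriv f p := by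
    rw [deriv_const_mul _ hf.differentiableAt]
  have hfun : (fun z => ‖f z‖ ^ 2) = fun z => (f z).re ^ 2 + (-Complex.I * f z).re ^ 2 := by
    funext z
    rw [← Complex.normSq_eq_norm_sq, Complex.normSq_apply]
    simp; ring
  rw [hfun]
  refine h.congr_data ?_ ?_
  · rw [hd]
    apply Complex.ext <;> simp <;> ring
  · rw [hd]; simp; ring

lemma nonpos_of_isLocalMax (hv : FujLap v p G a) (hm : IsLocalMax v p) : a ≤ 0 := by
  by_contra hpos
  push Not at hpos
  obtain ⟨H, hH⟩ := hv
  have hb := hH.bound (show (0:ℝ) < a / 8 by positivity)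
  have hm' : ∀ᶠ w in 𝓝 (0:ℂ), v (p + w) ≤ v p := by
    have : Tendsto (fun w : ℂ => p + w) (𝓝 0) (𝓝 p) := by
      have : ContinuousAt (fun w : ℂ => p + w) 0 := by fun_prop
      simpa [ContinuousAt] using this
    exact this.eventually hm
  obtain ⟨ε, hε, hball⟩ := Metric.eventually_nhds_iff.1 (hb.and hm')
  set w : ℂ := ((ε / 2 : ℝ) : ℂ) with hw
  have hwn : ‖w‖ = ε / 2 := by rw [hw, Complex.norm_real]; simp [abs_of_pos hε]
  have key : ∀ u : ℂ, ‖u‖ = 1 → (G * (u * w)).re + (H * (u * w) ^ 2).re + a / 8 * ‖w‖ ^ 2 ≤ 0 := by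
    intro u hu
    have hn : ‖u * w‖ = ‖w‖ := by simp [hu]
    have := hball (y := u * w) (by rw [dist_zero_right, hn, hwn]; linarith)
    obtain ⟨t1, t2⟩ := this
    rw [hn, Real.norm_eq_abs, Real.norm_eq_abs, abs_le, abs_of_nonneg (by positivity)] at t1
    linarith [t1.1]
  have k1 := key 1 (by simp)
  have k2 := key (-1) (by simp)
  have k3 := key Complex.I (by simp)
  have k4 := key (-Complex.I) (by simp)
  have e1 : (G * (-1 * w)).re = -(G * (1 * w)).re := by simp
  have e2 : (G * (-Complex.I * w)).re = -(G * (Complex.I * w)).re := by simp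
  have e3 : (H * (-1 * w) ^ 2).re = (H * (1 * w) ^ 2).re := by simp
  have e4 : (H * (Complex.I * w) ^ 2).re = -(H * (1 * w) ^ 2).re := by simp [mul_pow]
  have e5 : (H * (-Complex.I * w) ^ 2).re = -(H * (1 * w) ^ 2).re := by simp [mul_pow]
  have : 0 < a / 8 * ‖w‖ ^ 2 := by rw [hwn]; positivity
  linarith

end FujLap

namespace FujLap
open Filter Topology Asymptotics
variable {p : ℂ}

lemma log_norm_sq {f : ℂ → ℂ} (hf : AnalyticAt ℂ f p) (h0 : f p ≠ 0) :
    FujLap (fun z => Real.log (‖f z‖ ^ 2)) p (2 * (deriv f p / f p)) 0 := by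
  have hp : 0 < ‖f p‖ := norm_pos_iff.2 h0
  refine ((norm_sq hf).log (by positivity)).congr_data ?_ ?_
  · have : ((‖f p‖ ^ 2 : ℝ) : ℂ) = starRingEnd ℂ (f p) * f p := by
      rw [← Complex.normSq_eq_norm_sq, Complex.normSq_eq_conj_mul_self]
    rw [this]
    have hc : starRingEnd ℂ (f p) ≠ 0 := by simpa using h0
    field_simp
  · simp only [norm_mul, RCLike.norm_conj, Complex.norm_ofNat]
    field_simp
    ring

lemma fuj_lagrange (a b c d : ℂ) :
    ‖a * c + b * d‖ ^ 2 + ‖a * starRingEnd ℂ d - b * starRingEnd ℂ c‖ ^ 2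
      = (‖a‖ ^ 2 + ‖b‖ ^ 2) * (‖c‖ ^ 2 + ‖d‖ ^ 2) := by
  simp only [← Complex.normSq_eq_norm_sq, Complex.normSq_apply]
  simp
  ring

lemma log_pair {g h : ℂ → ℂ} (hg : AnalyticAt ℂ g p) (hh : AnalyticAt ℂ h p)
    (hN : 0 < ‖g p‖ ^ 2 + ‖h p‖ ^ 2) :
    FujLap (fun z => Real.log (‖g z‖ ^ 2 + ‖h z‖ ^ 2)) p
      (2 * (starRingEnd ℂ (g p) * deriv g p + starRingEnd ℂ (h p) * deriv h p)
        / ((‖g p‖ ^ 2 + ‖h p‖ ^ 2 : ℝ) : ℂ))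
      (4 * (‖deriv g p * h p - g p * deriv h p‖ / (‖g p‖ ^ 2 + ‖h p‖ ^ 2)) ^ 2) := by
  refine (((norm_sq hg).add (norm_sq hh)).log hN).congr_data ?_ ?_
  · rw [div_eq_inv_mul]; ring
  · have h1 := fuj_lagrange (deriv g p) (deriv h p) (starRingEnd ℂ (g p)) (starRingEnd ℂ (h p))
    simp only [RCLike.norm_conj, Complex.conj_conj] at h1
    have e1 : 2 * (starRingEnd ℂ (g p) * deriv g p) + 2 * (starRingEnd ℂ (h p) * deriv h p)
      = 2 * (deriv g p * starRingEnd ℂ (g p) + deriv h p * starRingEnd ℂ (h p)) := by ring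
    have e2 : deriv g p * h p - g p * deriv h p = deriv g p * h p - deriv h p * g p := by ring
    rw [e1, e2, norm_mul, Complex.norm_ofNat, mul_pow]
    field_simp
    linarith

lemma exp_term {g h : ℂ → ℂ} (hg : AnalyticAt ℂ g p) (hh : AnalyticAt ℂ h p)
    (hN : 0 < ‖g p‖ ^ 2 + ‖h p‖ ^ 2) (a b : ℂ) (hab : ‖a‖ ^ 2 + ‖b‖ ^ 2 = 1)
    (hF : a * g p + b * h p ≠ 0) (τ : ℝ) :
    ∃ G, FujLap (fun z => Real.exp (τ * (Real.log (‖a * g z + b * h z‖ ^ 2)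
        - Real.log (‖g z‖ ^ 2 + ‖h z‖ ^ 2)))) p G
      (4 * (‖deriv g p * h p - g p * deriv h p‖ / (‖g p‖ ^ 2 + ‖h p‖ ^ 2)) ^ 2 *
        (τ ^ 2 * (‖a * g p + b * h p‖ ^ 2 / (‖g p‖ ^ 2 + ‖h p‖ ^ 2)) ^ (τ - 1)
          - τ * (1 + τ) * (‖a * g p + b * h p‖ ^ 2 / (‖g p‖ ^ 2 + ‖h p‖ ^ 2)) ^ τ)) := by
  have hFa : AnalyticAt ℂ (fun z => a * g z + b * h z) p := by fun_prop
  have h1 := log_norm_sq hFa hF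
  have h2 := log_pair hg hh hN
  have h3 := ((h1.add (h2.const_mul (-1))).const_mul τ).exp
  have hFp : 0 < ‖a * g p + b * h p‖ := norm_pos_iff.2 hF
  have hd : deriv (fun z => a * g z + b * h z) p = a * deriv g p + b * deriv h p := by
    rw [deriv_fun_add (by fun_prop) (by fun_prop), deriv_const_mul _ hg.differentiableAt,
      deriv_const_mul _ hh.differentiableAt]
  have hfun : (fun z => Real.exp (τ * (Real.log (‖a * g z + b * h z‖ ^ 2)
        - Real.log (‖g z‖ ^ 2 + ‖h z‖ ^ 2)))) = fun z => Real.exp (τ *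
        (Real.log (‖a * g z + b * h z‖ ^ 2) + -1 * Real.log (‖g z‖ ^ 2 + ‖h z‖ ^ 2))) := by
    funext z; congr 1; ring
  rw [hfun]
  refine ⟨_, h3.congr_data rfl ?_⟩
  set N : ℝ := ‖g p‖ ^ 2 + ‖h p‖ ^ 2 with hNdef
  set F : ℂ := a * g p + b * h p with hFdef
  set W : ℂ := deriv g p * h p - g p * deriv h p with hW
  have hχ : 0 < ‖F‖ ^ 2 / N := by positivity
  have e0 : Real.exp (τ * (Real.log (‖F‖ ^ 2) + -1 * Real.log N)) = (‖F‖ ^ 2 / N) ^ τ := by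
    rw [Real.rpow_def_of_pos hχ, Real.log_div (by positivity) (by positivity)]
    congr 1; ring
  have e1 : (‖F‖ ^ 2 / N) ^ (τ - 1) = (‖F‖ ^ 2 / N) ^ τ / (‖F‖ ^ 2 / N) := by
    rw [Real.rpow_sub hχ, Real.rpow_one]
  have hNc : (N : ℂ) = g p * starRingEnd ℂ (g p) + h p * starRingEnd ℂ (h p) := by
    rw [hNdef, Complex.mul_conj, Complex.mul_conj, Complex.normSq_eq_norm_sq,
      Complex.normSq_eq_norm_sq]
    push_cast; rfl
  have hN0 : (N : ℂ) ≠ 0 := by exact_mod_cast hN.ne'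
  have eG : 2 * (deriv (fun z => a * g z + b * h z) p / F) + ((-1 : ℝ) : ℂ) *
      (2 * (starRingEnd ℂ (g p) * deriv g p + starRingEnd ℂ (h p) * deriv h p) / (N : ℂ))
      = 2 * (W * (a * starRingEnd ℂ (h p) - b * starRingEnd ℂ (g p))) / (F * N) := by
    rw [hd]
    push_cast
    field_simp
    rw [hNc, hFdef, hW]
    ring
  have hl := fuj_lagrange a b (g p) (h p)
  rw [hab, one_mul, ← hFdef, ← hNdef] at hl
  rw [e0, eG, e1]
  simp only [norm_mul, norm_div, Complex.norm_ofNat, Complex.norm_real, Real.norm_eq_abs,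
    abs_of_pos hN, mul_pow, div_pow, sq_abs]
  have hl' : ‖a * starRingEnd ℂ (h p) - b * starRingEnd ℂ (g p)‖ ^ 2 = N - ‖F‖ ^ 2 := by linarith
  rw [hl']
  field_simp
  ring

lemma log_hyp (r : ℝ) (hp : ‖p‖ < r) :
    ∃ G, FujLap (fun z => Real.log (r ^ 2 - ‖z‖ ^ 2)) p G
      (-(4 * r ^ 2 / (r ^ 2 - ‖p‖ ^ 2) ^ 2)) := by
  have h1 := norm_sq (p := p) (f := fun z => z) analyticAt_id
  have h2 := (const (p := p) (r ^ 2)).add (h1.const_mul (-1))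
  have hpos : 0 < r ^ 2 - ‖p‖ ^ 2 := by nlinarith [norm_nonneg p]
  have h3 := h2.log (by linarith)
  have hfun : (fun z : ℂ => Real.log (r ^ 2 - ‖z‖ ^ 2))
      = fun z => Real.log (r ^ 2 + -1 * ‖z‖ ^ 2) := by
    funext z; congr 1; ring
  rw [hfun]
  refine ⟨_, h3.congr_data rfl ?_⟩
  have : r ^ 2 + -1 * ‖p‖ ^ 2 = r ^ 2 - ‖p‖ ^ 2 := by ring
  rw [this]
  simp
  field_simp
  ring

end FujLap

/-- Squared norm of the pair `(g, h)`. -/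
noncomputable def fujN (g h : ℂ → ℂ) (z : ℂ) : ℝ := ‖g z‖ ^ 2 + ‖h z‖ ^ 2

/-- Wronskian. -/
noncomputable def fujW (g h : ℂ → ℂ) (z : ℂ) : ℂ := deriv g z * h z - g z * deriv h z

/-- Squared chordal distance to the point given by the linear form `(a, b)`. -/
noncomputable def fujX (g h : ℂ → ℂ) (a b : ℂ) (z : ℂ) : ℝ := ‖a * g z + b * h z‖ ^ 2 / fujN g h z

/-- The density of the comparison metric. -/
noncomputable def fujU {ι : Type*} (g h : ℂ → ℂ) (J : Finset ι) (a b : ι → ℂ) (β : ι → ℝ)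
    (κ τ : ℝ) (z : ℂ) : ℝ :=
  ‖fujW g h z‖ / fujN g h z * (∏ j ∈ J, fujX g h (a j) (b j) z ^ (-(β j / 2))) *
    Real.exp (κ * ∑ j ∈ J, fujX g h (a j) (b j) z ^ τ)

lemma fuj_prod_bound {ι : Type*} (J : Finset ι) (x β : ι → ℝ) (L s B M : ℝ) (hL : 0 < L)
    (hx0 : ∀ j ∈ J, 0 < x j) (hx1 : ∀ j ∈ J, x j ≤ 1)
    (hsep : ∀ i ∈ J, ∀ j ∈ J, i ≠ j → L ≤ Real.sqrt (x i) + Real.sqrt (x j))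
    (hβ0 : ∀ j ∈ J, 0 ≤ β j) (hβs : ∀ j ∈ J, β j ≤ s) (hB : ∑ j ∈ J, β j ≤ B)
    (hM1 : 1 ≤ M) (hM : ((L / 2) ^ 2)⁻¹ ≤ M) :
    ∏ j ∈ J, x j ^ (-β j) ≤ M ^ B * (1 + ∑ j ∈ J, x j ^ (-s)) := by
  classical
  have hM0 : 0 < M := by linarith
  have hsum : 0 ≤ ∑ j ∈ J, x j ^ (-s) :=
    Finset.sum_nonneg fun j hj => (Real.rpow_pos_of_pos (hx0 j hj) _).le
  have hbig : ∀ j ∈ J, L / 2 ≤ Real.sqrt (x j) → x j ^ (-β j) ≤ M ^ β j := by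
    intro j hj h
    rw [Real.rpow_neg (hx0 j hj).le, ← Real.inv_rpow (hx0 j hj).le]
    refine Real.rpow_le_rpow (inv_nonneg.2 (hx0 j hj).le) (le_trans ?_ hM) (hβ0 j hj)
    refine inv_anti₀ (by positivity) ?_
    calc (L / 2) ^ 2 ≤ Real.sqrt (x j) ^ 2 := by gcongr
      _ = x j := Real.sq_sqrt (hx0 j hj).le
  have hsub : ∀ K ⊆ J, (∀ j ∈ K, L / 2 ≤ Real.sqrt (x j)) → ∏ j ∈ K, x j ^ (-β j) ≤ M ^ B := by
    intro K hK hKL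
    calc ∏ j ∈ K, x j ^ (-β j) ≤ ∏ j ∈ K, M ^ β j :=
          Finset.prod_le_prod (fun j hj => (Real.rpow_pos_of_pos (hx0 j (hK hj)) _).le)
            (fun j hj => hbig j (hK hj) (hKL j hj))
      _ = M ^ (∑ j ∈ K, β j) := (Real.rpow_sum_of_pos hM0 _ _).symm
      _ ≤ M ^ B := by
          refine Real.rpow_le_rpow_of_exponent_le hM1 (le_trans ?_ hB)
          exact Finset.sum_le_sum_of_subset_of_nonneg hK fun j hj _ => hβ0 j hj
  have hMB : 0 < M ^ B := Real.rpow_pos_of_pos hM0 _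
  by_cases hex : ∃ j0 ∈ J, Real.sqrt (x j0) < L / 2
  · obtain ⟨j0, hj0, hlt⟩ := hex
    rw [← Finset.mul_prod_erase J _ hj0]
    have h1 : ∏ j ∈ J.erase j0, x j ^ (-β j) ≤ M ^ B := by
      refine hsub _ (Finset.erase_subset _ _) fun j hj => ?_
      have := hsep j (Finset.mem_of_mem_erase hj) j0 hj0 (Finset.ne_of_mem_erase hj)
      linarith
    have h2 : x j0 ^ (-β j0) ≤ x j0 ^ (-s) :=
      Real.rpow_le_rpow_of_exponent_ge (hx0 j0 hj0) (hx1 j0 hj0) (by linarith [hβs j0 hj0])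
    have h3 : x j0 ^ (-s) ≤ ∑ j ∈ J, x j ^ (-s) :=
      Finset.single_le_sum (f := fun j => x j ^ (-s))
        (fun j hj => (Real.rpow_pos_of_pos (hx0 j hj) _).le) hj0
    calc x j0 ^ (-β j0) * ∏ j ∈ J.erase j0, x j ^ (-β j)
        ≤ (1 + ∑ j ∈ J, x j ^ (-s)) * M ^ B := by
          refine mul_le_mul (by linarith) h1 ?_ (by linarith)
          exact Finset.prod_nonneg fun j hj =>
            (Real.rpow_pos_of_pos (hx0 j (Finset.mem_of_mem_erase hj)) _).le
      _ = _ := mul_comm _ _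
  · push Not at hex
    refine (hsub J subset_rfl hex).trans ?_
    nlinarith

open Filter Topology in
lemma fuj_max {ι : Type*} {g h : ℂ → ℂ} {p : ℂ} (hg : AnalyticAt ℂ g p) (hh : AnalyticAt ℂ h p)
    (J : Finset ι) (a b : ι → ℂ) (β : ι → ℝ) (κ τ r : ℝ)
    (hab : ∀ j ∈ J, ‖a j‖ ^ 2 + ‖b j‖ ^ 2 = 1)
    (hN : 0 < fujN g h p) (hF : ∀ j ∈ J, a j * g p + b j * h p ≠ 0) (hW : fujW g h p ≠ 0)
    (hp : ‖p‖ < r)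
    (hmax : IsLocalMax (fun z => fujU g h J a b β κ τ z * (r ^ 2 - ‖z‖ ^ 2)) p) :
    4 * (‖fujW g h p‖ / fujN g h p) ^ 2 * (((∑ j ∈ J, β j) / 2 - 1) + κ * ∑ j ∈ J,
      (τ ^ 2 * fujX g h (a j) (b j) p ^ (τ - 1) - τ * (1 + τ) * fujX g h (a j) (b j) p ^ τ))
      ≤ 4 * r ^ 2 / (r ^ 2 - ‖p‖ ^ 2) ^ 2 := by
  classical
  have hWa : AnalyticAt ℂ (fujW g h) p := by
    have := hg.deriv; have := hh.deriv
    unfold fujW; fun_prop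
  have hl1 := (FujLap.log_norm_sq hWa hW).const_mul (1 / 2)
  have hFa : ∀ j, AnalyticAt ℂ (fun z => a j * g z + b j * h z) p := fun j => by fun_prop
  have hl2 := FujLap.sum J (fun j z => -(β j / 2) * Real.log (‖a j * g z + b j * h z‖ ^ 2)) _ _
    (fun j hj => (FujLap.log_norm_sq (hFa j) (hF j hj)).const_mul (-(β j / 2)))
  have hl3 := (FujLap.log_pair hg hh hN).const_mul ((∑ j ∈ J, β j) / 2 - 1)
  choose! G hG using fun j (hj : j ∈ J) => FujLap.exp_term hg hh hN (a j) (b j) (hab j hj)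
    (hF j hj) τ
  have hl4 := (FujLap.sum J _ _ _ hG).const_mul κ
  obtain ⟨G5, hl5⟩ := FujLap.log_hyp r hp
  have hl := (((hl1.add hl2).add hl3).add hl4).add hl5
  have key := hl.nonpos_of_isLocalMax ?_
  · simp only [mul_zero, Finset.sum_const_zero, zero_add, ← Finset.mul_sum] at key
    simp only [fujX, fujN, fujW]
    linarith
  · skip
    have hgc := hg.continuousAt
    have hhc := hh.continuousAt
    have ev1 : ∀ᶠ z in 𝓝 p, fujW g h z ≠ 0 := hWa.continuousAt.eventually_ne hW
    have ev2 : ∀ᶠ z in 𝓝 p, ∀ j ∈ J, a j * g z + b j * h z ≠ 0 := by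
      rw [Finset.eventually_all]
      exact fun j hj => (hFa j).continuousAt.eventually_ne (hF j hj)
    have ev3 : ∀ᶠ z in 𝓝 p, 0 < fujN g h z := by
      have : ContinuousAt (fujN g h) p := by unfold fujN; fun_prop
      exact this.eventually (lt_mem_nhds hN)
    have ev4 : ∀ᶠ z in 𝓝 p, 0 < r ^ 2 - ‖z‖ ^ 2 := by
      have : ContinuousAt (fun z : ℂ => r ^ 2 - ‖z‖ ^ 2) p := by fun_prop
      exact this.eventually (lt_mem_nhds (by nlinarith [norm_nonneg p]))
    have hform : ∀ z, fujW g h z ≠ 0 → (∀ j ∈ J, a j * g z + b j * h z ≠ 0) → 0 < fujN g h z →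
        0 < r ^ 2 - ‖z‖ ^ 2 → 0 < fujU g h J a b β κ τ z * (r ^ 2 - ‖z‖ ^ 2) ∧
        Real.log (fujU g h J a b β κ τ z * (r ^ 2 - ‖z‖ ^ 2)) =
        1 / 2 * Real.log (‖fujW g h z‖ ^ 2)
          + ∑ j ∈ J, -(β j / 2) * Real.log (‖a j * g z + b j * h z‖ ^ 2)
          + ((∑ j ∈ J, β j) / 2 - 1) * Real.log (‖g z‖ ^ 2 + ‖h z‖ ^ 2)
          + κ * ∑ j ∈ J, Real.exp (τ * (Real.log (‖a j * g z + b j * h z‖ ^ 2)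
              - Real.log (‖g z‖ ^ 2 + ‖h z‖ ^ 2))) + Real.log (r ^ 2 - ‖z‖ ^ 2) := by
      intro z h1 h2 h3 h4
      have hW' : 0 < ‖fujW g h z‖ := norm_pos_iff.2 h1
      have hF2 : ∀ j ∈ J, 0 < ‖a j * g z + b j * h z‖ ^ 2 := fun j hj =>
        pow_pos (norm_pos_iff.2 (h2 j hj)) 2
      have hX : ∀ j ∈ J, 0 < fujX g h (a j) (b j) z := fun j hj => div_pos (hF2 j hj) h3
      have hlogX : ∀ j ∈ J, Real.log (fujX g h (a j) (b j) z)
          = Real.log (‖a j * g z + b j * h z‖ ^ 2) - Real.log (‖g z‖ ^ 2 + ‖h z‖ ^ 2) :=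
        fun j hj => Real.log_div (hF2 j hj).ne' h3.ne'
      have hpr : 0 < ∏ j ∈ J, fujX g h (a j) (b j) z ^ (-(β j / 2)) :=
        Finset.prod_pos fun j hj => Real.rpow_pos_of_pos (hX j hj) _
      have hU : 0 < fujU g h J a b β κ τ z := by unfold fujU; positivity
      refine ⟨by positivity, ?_⟩
      rw [Real.log_mul hU.ne' h4.ne']
      congr 1
      unfold fujU
      rw [Real.log_mul (by positivity) (by positivity), Real.log_exp,
        Real.log_mul (by positivity) hpr.ne', Real.log_div hW'.ne' h3.ne',
        Real.log_prod (fun j hj => (Real.rpow_pos_of_pos (hX j hj) _).ne')]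
      have e1 : ∑ j ∈ J, fujX g h (a j) (b j) z ^ τ = ∑ j ∈ J, Real.exp (τ *
          (Real.log (‖a j * g z + b j * h z‖ ^ 2) - Real.log (‖g z‖ ^ 2 + ‖h z‖ ^ 2))) := by
        refine Finset.sum_congr rfl fun j hj => ?_
        rw [Real.rpow_def_of_pos (hX j hj), hlogX j hj, mul_comm]
      have e2 : ∑ j ∈ J, Real.log (fujX g h (a j) (b j) z ^ (-(β j / 2)))
          = ∑ j ∈ J, -(β j / 2) * Real.log (‖a j * g z + b j * h z‖ ^ 2)
            + ((∑ j ∈ J, β j) / 2) * Real.log (‖g z‖ ^ 2 + ‖h z‖ ^ 2) := by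
        rw [Finset.sum_div, Finset.sum_mul, ← Finset.sum_add_distrib]
        refine Finset.sum_congr rfl fun j hj => ?_
        rw [Real.log_rpow (hX j hj), hlogX j hj]
        ring
      rw [e1, e2, Real.log_pow]
      simp only [fujN]
      push_cast
      ring
    filter_upwards [ev1, ev2, ev3, ev4, hmax] with z h1 h2 h3 h4 h5
    obtain ⟨hp1, hp2⟩ := hform p hW hF hN (by nlinarith [norm_nonneg p])
    obtain ⟨hz1, hz2⟩ := hform z h1 h2 h3 h4
    rw [← hp2, ← hz2]
    exact Real.log_le_log hz1 h5

open Filter Topology Asymptotics in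
lemma fuj_W_bigO {g h : ℂ → ℂ} {z0 : ℂ} (hg : AnalyticAt ℂ g z0) (hh : AnalyticAt ℂ h z0)
    (a b : ℂ) (hab : ‖a‖ ^ 2 + ‖b‖ ^ 2 = 1) (k : ℕ) (hk : 2 ≤ k)
    (hord : analyticOrderAt (fun z => a * g z + b * h z) z0 = k) :
    (fujW g h) =O[𝓝 z0] (fun z => ‖a * g z + b * h z‖ ^ (1 - 1 / (k : ℝ))) := by
  set F : ℂ → ℂ := fun z => a * g z + b * h z with hFdef
  have hFa : AnalyticAt ℂ F z0 := by fun_prop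
  obtain ⟨l, rfl⟩ : ∃ l, k = l + 1 := ⟨k - 1, by omega⟩
  obtain ⟨G, hGa, hG0, hFG⟩ := (hFa.analyticOrderAt_eq_natCast).1 hord
  have hord' : analyticOrderAt (deriv F) z0 = l :=
    analyticOrderAt_deriv_of_pos hFa (by simpa using hord)
  obtain ⟨G1, hG1a, _, hFG1⟩ := (hFa.deriv.analyticOrderAt_eq_natCast).1 hord'
  have hO : ∀ (e : ℂ → ℂ) (c : ℂ), AnalyticAt ℂ e z0 → c ≠ 0 →
      (∀ᶠ z in 𝓝 z0, c * fujW g h z = deriv F z * e z - F z * deriv e z) →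
      fujW g h =O[𝓝 z0] (fun z => (z - z0) ^ l) := by
    intro e c he hc hev
    have hQ : ContinuousAt (fun z => c⁻¹ * (G1 z * e z - (z - z0) * G z * deriv e z)) z0 := by
      have h1 := hG1a.continuousAt
      have h2 := he.continuousAt
      have h3 := hGa.continuousAt
      have h4 := he.deriv.continuousAt
      fun_prop
    have h1 : (fun z => (z - z0) ^ l * (c⁻¹ * (G1 z * e z - (z - z0) * G z * deriv e z)))
        =O[𝓝 z0] (fun z => (z - z0) ^ l * (1 : ℂ)) :=
      (isBigO_refl _ _).mul (hQ.isBigO_one ℂ)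
    simp only [mul_one] at h1
    refine h1.congr' ?_ (EventuallyEq.refl _ _)
    filter_upwards [hev, hFG, hFG1] with z h2 h3 h4
    rw [h3, h4] at h2
    simp only [smul_eq_mul] at h2
    have : fujW g h z = c⁻¹ * (c * fujW g h z) := by field_simp
    rw [this, h2]
    ring
  have hd : ∀ᶠ z in 𝓝 z0, deriv F z = a * deriv g z + b * deriv h z := by
    filter_upwards [hg.eventually_analyticAt, hh.eventually_analyticAt] with z h1 h2
    rw [hFdef, deriv_fun_add (by fun_prop) (by fun_prop), deriv_const_mul _ h1.differentiableAt,
      deriv_const_mul _ h2.differentiableAt]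
  have hW : fujW g h =O[𝓝 z0] (fun z => (z - z0) ^ l) := by
    by_cases ha : a = 0
    · have hb : b ≠ 0 := by
        rintro rfl; simp [ha] at hab
      refine hO g (-b) hg (neg_ne_zero.2 hb) ?_
      filter_upwards [hd] with z hz
      rw [hz]; simp only [hFdef, fujW]; ring
    · refine hO h a hh ha ?_
      filter_upwards [hd] with z hz
      rw [hz]; simp only [hFdef, fujW]; ring
  refine hW.trans ?_
  have h1 : (fun z => (z - z0) ^ (l + 1)) =O[𝓝 z0] F := by
    have hGi : ContinuousAt (fun z => (G z)⁻¹) z0 := hGa.continuousAt.inv₀ hG0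
    have h2 : (fun z => F z * (G z)⁻¹) =O[𝓝 z0] (fun z => F z * (1 : ℂ)) :=
      (isBigO_refl _ _).mul (hGi.isBigO_one ℂ)
    simp only [mul_one] at h2
    refine h2.congr' ?_ (EventuallyEq.refl _ _)
    filter_upwards [hFG, hGa.continuousAt.eventually_ne hG0] with z h3 h4
    rw [h3, smul_eq_mul]
    field_simp
  have h2 : (fun z => ‖(z - z0) ^ (l + 1)‖) =O[𝓝 z0] (fun z => ‖F z‖) := h1.norm_norm
  have hl1 : (0:ℝ) < (l:ℝ) + 1 := by positivity
  have h3 := h2.rpow (r := 1 - 1 / ((l + 1 : ℕ) : ℝ)) (by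
    push_cast
    rw [sub_nonneg, div_le_one hl1]; linarith [(Nat.cast_nonneg l : (0:ℝ) ≤ l)])
    (Eventually.of_forall fun z => norm_nonneg _)
  refine IsBigO.trans (IsBigO.of_bound 1 (Eventually.of_forall fun z => ?_)) h3
  rw [one_mul, norm_pow, norm_pow, Real.norm_eq_abs, abs_of_nonneg (by positivity)]
  rw [← Real.rpow_natCast ‖z - z0‖ (l + 1), ← Real.rpow_mul (norm_nonneg _)]
  have : ((l + 1 : ℕ) : ℝ) * (1 - 1 / ((l + 1 : ℕ) : ℝ)) = l := by
    push_cast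
    field_simp
    ring
  rw [this, Real.rpow_natCast]

open Filter Topology Asymptotics in
lemma fuj_tendsto {g h : ℂ → ℂ} {z0 : ℂ} (hg : AnalyticAt ℂ g z0) (hh : AnalyticAt ℂ h z0)
    (a b : ℂ) (hab : ‖a‖ ^ 2 + ‖b‖ ^ 2 = 1) (hN : 0 < fujN g h z0)
    (hF0 : a * g z0 + b * h z0 = 0) (m : ℕ) (hm : 2 ≤ m)
    (hmo : (m : ℕ∞) ≤ analyticOrderAt (fun z => a * g z + b * h z) z0)
    (htop : analyticOrderAt (fun z => a * g z + b * h z) z0 ≠ ⊤)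
    (β s : ℝ) (hβ : β ≤ (1 - 1 / (m : ℝ)) * s) (hs0 : 0 ≤ s) (hs : s < 1) :
    fujW g h z0 = 0 ∧
    Tendsto (fun z => ‖fujW g h z‖ * fujX g h a b z ^ (-(β / 2))) (𝓝 z0) (𝓝 0) := by
  obtain ⟨k, hk⟩ := ENat.ne_top_iff_exists.1 htop
  have hmk : m ≤ k := by
    rw [← hk] at hmo; exact_mod_cast hmo
  have hB := fuj_W_bigO hg hh a b hab k (by omega) hk.symm
  have hmR : (2:ℝ) ≤ m := by exact_mod_cast hm
  have hmkR : (m:ℝ) ≤ k := by exact_mod_cast hmk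
  have hk1 : 1 / (k:ℝ) ≤ 1 / m := one_div_le_one_div_of_le (by linarith) hmkR
  have hk2 : 1 / (k:ℝ) ≤ 1 / 2 := one_div_le_one_div_of_le (by linarith) (by linarith)
  have hexp : 0 < 1 - 1 / (k : ℝ) - β := by nlinarith
  have hexp2 : 1 - 1 / (k : ℝ) ≠ 0 := by linarith
  obtain ⟨C, hC⟩ := hB.bound
  have hW0 : fujW g h z0 = 0 := by
    have := hC.self_of_nhds
    rw [hF0, norm_zero, Real.zero_rpow hexp2, norm_zero, mul_zero] at this
    exact norm_le_zero_iff.1 this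
  refine ⟨hW0, ?_⟩
  have hNc : ContinuousAt (fujN g h) z0 := by
    have := hg.continuousAt; have := hh.continuousAt
    unfold fujN; fun_prop
  have hFc : ContinuousAt (fun z => ‖a * g z + b * h z‖) z0 := by
    have := hg.continuousAt; have := hh.continuousAt
    fun_prop
  have hlim : Tendsto (fun z => C * ‖a * g z + b * h z‖ ^ (1 - 1 / (k : ℝ) - β)
      * fujN g h z ^ (β / 2)) (𝓝 z0) (𝓝 0) := by
    have h1 : ContinuousAt (fun z => C * ‖a * g z + b * h z‖ ^ (1 - 1 / (k : ℝ) - β)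
      * fujN g h z ^ (β / 2)) z0 :=
      (continuousAt_const.mul (hFc.rpow_const (Or.inr hexp.le))).mul
        (hNc.rpow_const (Or.inl hN.ne'))
    have h2 := h1.tendsto
    simp only [hF0, norm_zero] at h2
    rwa [Real.zero_rpow hexp.ne', mul_zero, zero_mul] at h2
  refine squeeze_zero' ?_ ?_ hlim
  · refine Eventually.of_forall fun z => ?_
    have : 0 ≤ fujX g h a b z := by unfold fujX fujN; positivity
    positivity
  · filter_upwards [hC, hNc.eventually (lt_mem_nhds hN)] with z h1 h2
    by_cases hz : a * g z + b * h z = 0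
    · rw [hz, norm_zero, Real.zero_rpow hexp2, norm_zero, mul_zero] at h1
      have : ‖fujW g h z‖ = 0 := le_antisymm h1 (norm_nonneg _)
      rw [this, hz, norm_zero, Real.zero_rpow hexp.ne']
      simp
    · have hFp : 0 < ‖a * g z + b * h z‖ := norm_pos_iff.2 hz
      rw [Real.norm_eq_abs, abs_of_nonneg (by positivity)] at h1
      have e : fujX g h a b z ^ (-(β / 2)) = ‖a * g z + b * h z‖ ^ (-β) * fujN g h z ^ (β / 2) := by
        unfold fujX
        rw [Real.div_rpow (by positivity) h2.le, Real.rpow_neg h2.le, div_inv_eq_mul,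
          ← Real.rpow_natCast, ← Real.rpow_mul (norm_nonneg _)]
        congr 2
        push_cast; ring
      rw [e, Real.rpow_sub hFp]
      calc ‖fujW g h z‖ * (‖a * g z + b * h z‖ ^ (-β) * fujN g h z ^ (β / 2))
          ≤ (C * ‖a * g z + b * h z‖ ^ (1 - 1 / (k:ℝ))) *
            (‖a * g z + b * h z‖ ^ (-β) * fujN g h z ^ (β / 2)) := by gcongr
        _ = _ := by rw [Real.rpow_neg hFp.le]; ring

open Filter Topology Asymptotics in
lemma fuj_continuousAt {ι : Type*} {g h : ℂ → ℂ} {z0 : ℂ} (hg : AnalyticAt ℂ g z0)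
    (hh : AnalyticAt ℂ h z0) (J : Finset ι) (a b : ι → ℂ) (m : ι → ℕ) (β : ι → ℝ) (κ τ s : ℝ)
    (hab : ∀ j ∈ J, ‖a j‖ ^ 2 + ‖b j‖ ^ 2 = 1) (hN : 0 < fujN g h z0)
    (huniq : ∀ i ∈ J, ∀ j ∈ J, i ≠ j → a i * g z0 + b i * h z0 = 0 → a j * g z0 + b j * h z0 ≠ 0)
    (hm : ∀ j ∈ J, 2 ≤ m j)
    (hmo : ∀ j ∈ J, a j * g z0 + b j * h z0 = 0 →
      (m j : ℕ∞) ≤ analyticOrderAt (fun z => a j * g z + b j * h z) z0)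
    (htop : ∀ j ∈ J, analyticOrderAt (fun z => a j * g z + b j * h z) z0 ≠ ⊤)
    (hβ : ∀ j ∈ J, β j ≤ (1 - 1 / (m j : ℝ)) * s) (hs0 : 0 ≤ s) (hs : s < 1) (hτ : 0 ≤ τ) :
    ContinuousAt (fujU g h J a b β κ τ) z0 := by
  classical
  have hgc := hg.continuousAt
  have hhc := hh.continuousAt
  have hNc : ContinuousAt (fujN g h) z0 := by unfold fujN; fun_prop
  have hWc : ContinuousAt (fujW g h) z0 := by
    have := hg.deriv.continuousAt
    have := hh.deriv.continuousAt
    unfold fujW; fun_prop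
  have hXc : ∀ j, ContinuousAt (fujX g h (a j) (b j)) z0 := by
    intro j
    have : ContinuousAt (fun z => ‖a j * g z + b j * h z‖ ^ 2) z0 := by fun_prop
    exact this.div hNc hN.ne'
  have hX0 : ∀ j, a j * g z0 + b j * h z0 ≠ 0 → fujX g h (a j) (b j) z0 ≠ 0 := by
    intro j hj
    have : 0 < ‖a j * g z0 + b j * h z0‖ := norm_pos_iff.2 hj
    exact (div_pos (by positivity) hN).ne'
  have hE : ContinuousAt (fun z => Real.exp (κ * ∑ j ∈ J, fujX g h (a j) (b j) z ^ τ)) z0 := by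
    refine Real.continuous_exp.continuousAt.comp (continuousAt_const.mul ?_)
    exact tendsto_finsetSum _ fun j _ => (hXc j).rpow_const (Or.inr hτ)
  have hP : ∀ K ⊆ J, (∀ j ∈ K, a j * g z0 + b j * h z0 ≠ 0) →
      ContinuousAt (fun z => ∏ j ∈ K, fujX g h (a j) (b j) z ^ (-(β j / 2))) z0 := by
    intro K _ hK
    exact tendsto_finsetProd _ fun j hj => (hXc j).rpow_const (Or.inl (hX0 j (hK j hj)))
  by_cases hex : ∃ j0 ∈ J, a j0 * g z0 + b j0 * h z0 = 0
  · obtain ⟨j0, hj0, hz⟩ := hex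
    obtain ⟨hW0, hlim⟩ := fuj_tendsto hg hh (a j0) (b j0) (hab j0 hj0) hN hz (m j0) (hm j0 hj0)
      (hmo j0 hj0 hz) (htop j0 hj0) (β j0) s (hβ j0 hj0) hs0 hs
    have hrest : ContinuousAt (fun z => (fujN g h z)⁻¹ *
        (∏ j ∈ J.erase j0, fujX g h (a j) (b j) z ^ (-(β j / 2))) *
        Real.exp (κ * ∑ j ∈ J, fujX g h (a j) (b j) z ^ τ)) z0 := by
      refine ((hNc.inv₀ hN.ne').mul (hP _ (Finset.erase_subset _ _) fun j hj => ?_)).mul hE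
      exact huniq j0 hj0 j (Finset.mem_of_mem_erase hj) (Finset.ne_of_mem_erase hj).symm hz
    have h0 : fujU g h J a b β κ τ z0 = 0 := by simp [fujU, hW0]
    have := hlim.mul hrest.tendsto
    rw [zero_mul] at this
    rw [ContinuousAt, h0]
    refine this.congr fun z => ?_
    unfold fujU
    rw [← Finset.mul_prod_erase J _ hj0]
    ring
  · push Not at hex
    exact ((hWc.norm.div hNc hN.ne').mul (hP J subset_rfl hex)).mul hE

lemma fuj_alg {ι : Type*} (J : Finset ι) (x m : ι → ℝ) (gam s L M κ A c0 σ D r : ℝ) (hL : 0 < L)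
    (hs0 : 0 < s) (hs1 : s < 1) (hgam : 0 < gam)
    (hm : ∀ j ∈ J, 2 ≤ m j) (hsum : ∑ j ∈ J, (1 - 1 / m j) = gam)
    (hx0 : ∀ j ∈ J, 0 < x j) (hx1 : ∀ j ∈ J, x j ≤ 1)
    (hsep : ∀ i ∈ J, ∀ j ∈ J, i ≠ j → L ≤ Real.sqrt (x i) + Real.sqrt (x j))
    (hM1 : 1 ≤ M) (hM : ((L / 2) ^ 2)⁻¹ ≤ M)
    (hA : 0 < A) (hAdef : A = gam * s / 2 - 1) (hκ : κ = A / (8 * gam))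
    (hc0 : 0 < c0) (hcA : c0 ≤ A / 2) (hcκ : c0 ≤ κ * (1 - s) ^ 2)
    (hmain : 4 * σ ^ 2 * (((∑ j ∈ J, (1 - 1 / m j) * s) / 2 - 1) + κ * ∑ j ∈ J,
      ((1 - s) ^ 2 * x j ^ ((1 - s) - 1) - (1 - s) * (1 + (1 - s)) * x j ^ (1 - s)))
      ≤ 4 * r ^ 2 / D ^ 2) :
    c0 / (M ^ (gam * s) * Real.exp (4 * κ * gam)) *
      (σ * (∏ j ∈ J, x j ^ (-((1 - 1 / m j) * s / 2))) *
        Real.exp (κ * ∑ j ∈ J, x j ^ (1 - s))) ^ 2 ≤ r ^ 2 / D ^ 2 := by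
  have hκ0 : 0 < κ := by rw [hκ]; positivity
  have hM0 : 0 < M := by linarith
  have hm' : ∀ j ∈ J, 1 / 2 ≤ 1 - 1 / m j ∧ 1 - 1 / m j ≤ 1 := by
    intro j hj
    have h1 := hm j hj
    have h2 : 1 / m j ≤ 1 / 2 := one_div_le_one_div_of_le (by norm_num) h1
    have h3 : 0 < 1 / m j := by positivity
    constructor <;> linarith
  have hcard : (J.card : ℝ) ≤ 2 * gam := by
    have : ∑ j ∈ J, (1 / 2 : ℝ) ≤ ∑ j ∈ J, (1 - 1 / m j) :=
      Finset.sum_le_sum fun j hj => (hm' j hj).1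
    rw [hsum, Finset.sum_const, nsmul_eq_mul] at this
    linarith
  set S := ∑ j ∈ J, x j ^ (-s) with hS
  set T := ∑ j ∈ J, x j ^ (1 - s) with hT
  have hS0 : 0 ≤ S := Finset.sum_nonneg fun j hj => (Real.rpow_pos_of_pos (hx0 j hj) _).le
  have hT1 : T ≤ 2 * gam := by
    refine le_trans ?_ hcard
    calc T ≤ ∑ j ∈ J, (1:ℝ) := Finset.sum_le_sum fun j hj =>
          Real.rpow_le_one (hx0 j hj).le (hx1 j hj) (by linarith)
      _ = _ := by simp
  have hβsum : ∑ j ∈ J, (1 - 1 / m j) * s = gam * s := by rw [← Finset.sum_mul, hsum]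
  have hprod := fuj_prod_bound J x (fun j => (1 - 1 / m j) * s) L s (gam * s) M hL hx0 hx1 hsep
    (fun j hj => mul_nonneg (by linarith [(hm' j hj).1]) hs0.le)
    (fun j hj => by nlinarith [(hm' j hj).2]) hβsum.le hM1 hM
  have hbr : ∑ j ∈ J, ((1 - s) ^ 2 * x j ^ ((1 - s) - 1)
      - (1 - s) * (1 + (1 - s)) * x j ^ (1 - s)) = (1 - s) ^ 2 * S - (1 - s) * (1 + (1 - s)) * T := by
    rw [Finset.sum_sub_distrib, ← Finset.mul_sum, ← Finset.mul_sum]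
    have : (1 - s) - 1 = -s := by ring
    rw [this]
  rw [hbr, hβsum, ← hAdef] at hmain
  have hT0 : 0 ≤ T := Finset.sum_nonneg fun j hj => (Real.rpow_pos_of_pos (hx0 j hj) _).le
  have hκT : κ * ((1 - s) * (1 + (1 - s)) * T) ≤ A / 2 := by
    have h1 : (1 - s) * (1 + (1 - s)) ≤ 2 := by nlinarith
    have h2 : (1 - s) * (1 + (1 - s)) * T ≤ 2 * (2 * gam) := by
      refine mul_le_mul h1 hT1 hT0 (by norm_num)
    calc κ * ((1 - s) * (1 + (1 - s)) * T) ≤ κ * (2 * (2 * gam)) := by gcongr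
      _ = A / 2 := by rw [hκ]; field_simp; norm_num
  have hlow : c0 * (1 + S) ≤ A + κ * ((1 - s) ^ 2 * S - (1 - s) * (1 + (1 - s)) * T) := by
    have : c0 * S ≤ κ * (1 - s) ^ 2 * S := by gcongr
    have e : A + κ * ((1 - s) ^ 2 * S - (1 - s) * (1 + (1 - s)) * T)
      = A + κ * (1 - s) ^ 2 * S - κ * ((1 - s) * (1 + (1 - s)) * T) := by ring
    rw [e, mul_add, mul_one]
    linarith
  have h4 : σ ^ 2 * (c0 * (1 + S)) ≤ r ^ 2 / D ^ 2 := by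
    have : σ ^ 2 * (c0 * (1 + S)) ≤
        σ ^ 2 * (A + κ * ((1 - s) ^ 2 * S - (1 - s) * (1 + (1 - s)) * T)) := by gcongr
    have e : 4 * r ^ 2 / D ^ 2 = 4 * (r ^ 2 / D ^ 2) := by ring
    rw [e, mul_assoc] at hmain
    linarith
  refine le_trans ?_ h4
  have hP2 : (∏ j ∈ J, x j ^ (-((1 - 1 / m j) * s / 2))) ^ 2
      = ∏ j ∈ J, x j ^ (-((1 - 1 / m j) * s)) := by
    rw [← Finset.prod_pow]
    refine Finset.prod_congr rfl fun j hj => ?_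
    rw [← Real.rpow_natCast, ← Real.rpow_mul (hx0 j hj).le]
    congr 1
    push_cast; ring
  have hE2 : Real.exp (κ * T) ^ 2 ≤ Real.exp (4 * κ * gam) := by
    rw [← Real.exp_nat_mul]
    refine Real.exp_le_exp.2 ?_
    push_cast
    have : κ * T ≤ κ * (2 * gam) := by gcongr
    linarith
  have hMB : 0 < M ^ (gam * s) := Real.rpow_pos_of_pos hM0 _
  have hEp := Real.exp_pos (4 * κ * gam)
  rw [mul_pow, mul_pow, hP2, div_mul_eq_mul_div, div_le_iff₀ (by positivity)]
  calc c0 * (σ ^ 2 * (∏ j ∈ J, x j ^ (-((1 - 1 / m j) * s))) * Real.exp (κ * T) ^ 2)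
      ≤ c0 * (σ ^ 2 * (M ^ (gam * s) * (1 + S)) * Real.exp (4 * κ * gam)) := by gcongr
    _ = _ := by ring

lemma fuj_sep (a b a' b' x y : ℂ) (L : ℝ) (hab : ‖a‖ ^ 2 + ‖b‖ ^ 2 = 1)
    (hab' : ‖a'‖ ^ 2 + ‖b'‖ ^ 2 = 1) (hsep : L ≤ ‖a * b' - a' * b‖)
    (hN : 0 < ‖x‖ ^ 2 + ‖y‖ ^ 2) :
    L ≤ Real.sqrt (‖a * x + b * y‖ ^ 2 / (‖x‖ ^ 2 + ‖y‖ ^ 2))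
      + Real.sqrt (‖a' * x + b' * y‖ ^ 2 / (‖x‖ ^ 2 + ‖y‖ ^ 2)) := by
  set N := ‖x‖ ^ 2 + ‖y‖ ^ 2 with hNd
  have hsN : 0 < Real.sqrt N := Real.sqrt_pos.2 hN
  rw [Real.sqrt_div (by positivity), Real.sqrt_div (by positivity), Real.sqrt_sq (norm_nonneg _),
    Real.sqrt_sq (norm_nonneg _), ← add_div, le_div_iff₀ hsN]
  refine (mul_le_mul_of_nonneg_right hsep hsN.le).trans ?_
  refine abs_le_of_sq_le_sq' ?_ (by positivity) |>.2
  rw [mul_pow, Real.sq_sqrt hN.le]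
  set F := a * x + b * y with hF
  set F' := a' * x + b' * y with hF'
  have ex : (a * b' - a' * b) * x = F * b' - F' * b := by rw [hF, hF']; ring
  have ey : (a * b' - a' * b) * y = a * F' - a' * F := by rw [hF, hF']; ring
  have nx : ‖a * b' - a' * b‖ * ‖x‖ ≤ ‖F‖ * ‖b'‖ + ‖F'‖ * ‖b‖ := by
    rw [← norm_mul, ex, ← norm_mul, ← norm_mul]; exact norm_sub_le _ _
  have ny : ‖a * b' - a' * b‖ * ‖y‖ ≤ ‖a‖ * ‖F'‖ + ‖a'‖ * ‖F‖ := by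
    rw [← norm_mul, ey, ← norm_mul, ← norm_mul]; exact norm_sub_le _ _
  have nx2 := pow_le_pow_left₀ (by positivity) nx 2
  have ny2 := pow_le_pow_left₀ (by positivity) ny 2
  have hcs : ‖b‖ * ‖b'‖ + ‖a‖ * ‖a'‖ ≤ 1 := by
    nlinarith [sq_nonneg (‖b‖ - ‖b'‖), sq_nonneg (‖a‖ - ‖a'‖)]
  have hFF : 0 ≤ ‖F‖ * ‖F'‖ := by positivity
  have key : (‖F‖ * ‖b'‖ + ‖F'‖ * ‖b‖) ^ 2 + (‖a‖ * ‖F'‖ + ‖a'‖ * ‖F‖) ^ 2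
      = ‖F‖ ^ 2 * (‖a'‖ ^ 2 + ‖b'‖ ^ 2) + ‖F'‖ ^ 2 * (‖a‖ ^ 2 + ‖b‖ ^ 2)
        + 2 * (‖F‖ * ‖F'‖) * (‖b‖ * ‖b'‖ + ‖a‖ * ‖a'‖) := by ring
  rw [hab, hab'] at key
  have : 2 * (‖F‖ * ‖F'‖) * (‖b‖ * ‖b'‖ + ‖a‖ * ‖a'‖) ≤ 2 * (‖F‖ * ‖F'‖) * 1 := by gcongr
  rw [hNd]
  nlinarith

open Filter Topology in
lemma fuj_core (gam s L : ℝ) (hgam : 2 < gam) (hs0 : 0 < s) (hs1 : s < 1) (hgs : 2 < gam * s)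
    (hL : 0 < L) : ∃ C : ℝ, 0 < C ∧ ∀ (ι : Type) (J : Finset ι) (a b : ι → ℂ) (m : ι → ℕ),
      (∀ j ∈ J, ‖a j‖ ^ 2 + ‖b j‖ ^ 2 = 1) → (∀ j ∈ J, 2 ≤ m j) →
      ∑ j ∈ J, (1 - 1 / (m j : ℝ)) = gam →
      (∀ i ∈ J, ∀ j ∈ J, i ≠ j → L ≤ ‖a i * b j - a j * b i‖) →
      ∀ (R : ℝ) (g h : ℂ → ℂ), 0 < R →
      (∀ z ∈ Metric.ball (0:ℂ) R, AnalyticAt ℂ g z) →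
      (∀ z ∈ Metric.ball (0:ℂ) R, AnalyticAt ℂ h z) →
      (∀ z ∈ Metric.ball (0:ℂ) R, 0 < fujN g h z) →
      (∀ j ∈ J, ∀ z ∈ Metric.ball (0:ℂ) R, a j * g z + b j * h z = 0 →
        (m j : ℕ∞) ≤ analyticOrderAt (fun z => a j * g z + b j * h z) z) →
      (∀ j ∈ J, ∀ z ∈ Metric.ball (0:ℂ) R,
        analyticOrderAt (fun z => a j * g z + b j * h z) z ≠ ⊤) →
      ∀ z ∈ Metric.ball (0:ℂ) R, ‖fujW g h z‖ / fujN g h z ≤ C * R / (R ^ 2 - ‖z‖ ^ 2) *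
        ∏ j ∈ J, fujX g h (a j) (b j) z ^ ((1 - 1 / (m j : ℝ)) * s / 2) := by
  obtain ⟨A, hAdef⟩ : ∃ A, A = gam * s / 2 - 1 := ⟨_, rfl⟩
  have hA : 0 < A := by linarith
  have hgam0 : 0 < gam := by linarith
  obtain ⟨κ, hκ⟩ : ∃ κ, κ = A / (8 * gam) := ⟨_, rfl⟩
  have hκ0 : 0 < κ := by rw [hκ]; positivity
  obtain ⟨M, hMd⟩ : ∃ M, M = max 1 ((L / 2) ^ 2)⁻¹ := ⟨_, rfl⟩
  have hM1 : 1 ≤ M := hMd ▸ le_max_left _ _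
  have hM : ((L / 2) ^ 2)⁻¹ ≤ M := hMd ▸ le_max_right _ _
  have hs1' : 0 < 1 - s := by linarith
  obtain ⟨c0, hc0d⟩ : ∃ c0, c0 = min (A / 2) (κ * (1 - s) ^ 2) := ⟨_, rfl⟩
  have hc0 : 0 < c0 := by rw [hc0d]; exact lt_min (by positivity) (by positivity)
  have hcA : c0 ≤ A / 2 := hc0d ▸ min_le_left _ _
  have hcκ : c0 ≤ κ * (1 - s) ^ 2 := hc0d ▸ min_le_right _ _
  obtain ⟨c, hcd⟩ : ∃ c, c = c0 / (M ^ (gam * s) * Real.exp (4 * κ * gam)) := ⟨_, rfl⟩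
  have hM0 : 0 < M := by linarith
  have hc : 0 < c := by rw [hcd]; positivity
  have hsc : 0 < Real.sqrt c := Real.sqrt_pos.2 hc
  refine ⟨1 / Real.sqrt c, by positivity, ?_⟩
  intro ι J a b m hab hm hsum hsep R g h hR hg hh hN hmo htop
  set β : ι → ℝ := fun j => (1 - 1 / (m j : ℝ)) * s with hβ
  have hβ0 : ∀ j ∈ J, 0 < β j := by
    intro j hj
    have h1 : (2:ℝ) ≤ m j := by exact_mod_cast hm j hj
    have h2 : 1 / (m j : ℝ) ≤ 1 / 2 := one_div_le_one_div_of_le (by norm_num) h1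
    exact mul_pos (by linarith) hs0
  have hsepz : ∀ z ∈ Metric.ball (0:ℂ) R, ∀ i ∈ J, ∀ j ∈ J, i ≠ j →
      L ≤ Real.sqrt (fujX g h (a i) (b i) z) + Real.sqrt (fujX g h (a j) (b j) z) := by
    intro z hz i hi j hj hij
    exact fuj_sep _ _ _ _ _ _ L (hab i hi) (hab j hj) (hsep i hi j hj hij) (hN z hz)
  have huniq : ∀ z ∈ Metric.ball (0:ℂ) R, ∀ i ∈ J, ∀ j ∈ J, i ≠ j →
      a i * g z + b i * h z = 0 → a j * g z + b j * h z ≠ 0 := by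
    intro z hz i hi j hj hij h1 h2
    have := hsepz z hz i hi j hj hij
    simp [fujX, h1, h2] at this
    linarith
  set U := fujU g h J a b β κ (1 - s) with hU
  have hUc : ∀ z ∈ Metric.ball (0:ℂ) R, ContinuousAt U z := fun z hz =>
    fuj_continuousAt (hg z hz) (hh z hz) J a b m β κ (1 - s) s hab (hN z hz) (huniq z hz) hm
      (fun j hj => hmo j hj z hz) (fun j hj => htop j hj z hz) (fun j _ => le_rfl) hs0.le hs1
      hs1'.le
  have step1 : ∀ r, 0 < r → r < R → ∀ z, ‖z‖ ≤ r →
      U z * (r ^ 2 - ‖z‖ ^ 2) ≤ 1 / Real.sqrt c * r := by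
    intro r hr hrR z hz
    have hsub : Metric.closedBall (0:ℂ) r ⊆ Metric.ball 0 R := Metric.closedBall_subset_ball hrR
    have hcont : ContinuousOn (fun z => U z * (r ^ 2 - ‖z‖ ^ 2)) (Metric.closedBall 0 r) := by
      intro y hy
      refine ((hUc y (hsub hy)).mul ?_).continuousWithinAt
      fun_prop
    obtain ⟨p, hpm, hpmax⟩ := (isCompact_closedBall (0:ℂ) r).exists_isMaxOn
      ⟨0, by simp [hr.le]⟩ hcont
    have hzp : U z * (r ^ 2 - ‖z‖ ^ 2) ≤ U p * (r ^ 2 - ‖p‖ ^ 2) := hpmax (by simpa using hz)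
    refine hzp.trans ?_
    by_cases hpos : U p * (r ^ 2 - ‖p‖ ^ 2) ≤ 0
    · exact hpos.trans (by positivity)
    push Not at hpos
    have hpr : ‖p‖ ≤ r := by simpa using hpm
    have hpr' : ‖p‖ < r := by
      refine lt_of_le_of_ne hpr fun he => ?_
      rw [he] at hpos; simp at hpos
    have hD : 0 < r ^ 2 - ‖p‖ ^ 2 := by nlinarith [norm_nonneg p]
    have hUp : U p ≠ 0 := by intro he; rw [he] at hpos; simp at hpos
    have hpR := hsub hpm
    have hW : fujW g h p ≠ 0 := by
      intro he; apply hUp; simp [hU, fujU, he]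
    have hF : ∀ j ∈ J, a j * g p + b j * h p ≠ 0 := by
      intro j hj he
      apply hUp
      have hx : fujX g h (a j) (b j) p = 0 := by simp [fujX, he]
      have : ∏ j ∈ J, fujX g h (a j) (b j) p ^ (-(β j / 2)) = 0 := by
        refine Finset.prod_eq_zero hj ?_
        rw [hx, Real.zero_rpow (by have := hβ0 j hj; linarith)]
      simp [hU, fujU, this]
    have hloc : IsLocalMax (fun z => U z * (r ^ 2 - ‖z‖ ^ 2)) p :=
      hpmax.isLocalMax (Filter.mem_of_superset
        (Metric.isOpen_ball.mem_nhds (by simpa using hpr')) Metric.ball_subset_closedBall)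
    have hmx := fuj_max (hg p hpR) (hh p hpR) J a b β κ (1 - s) r hab (hN p hpR) hF hW hpr' hloc
    have hNp := hN p hpR
    have halg := fuj_alg J (fun j => fujX g h (a j) (b j) p) (fun j => (m j : ℝ)) gam s L M κ A c0
      (‖fujW g h p‖ / fujN g h p) (r ^ 2 - ‖p‖ ^ 2) r hL hs0 hs1 hgam0
      (fun j hj => by exact_mod_cast hm j hj) hsum
      (fun j hj => div_pos (pow_pos (norm_pos_iff.2 (hF j hj)) 2) hNp)
      (fun j hj => by
        have := FujLap.fuj_lagrange (a j) (b j) (g p) (h p)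
        rw [hab j hj, one_mul] at this
        refine (div_le_one hNp).2 ?_
        unfold fujN
        nlinarith [sq_nonneg ‖a j * starRingEnd ℂ (h p) - b j * starRingEnd ℂ (g p)‖])
      (hsepz p hpR) hM1 hM hA hAdef hκ hc0 hcA hcκ hmx
    rw [← hcd] at halg
    have halg' : c * U p ^ 2 ≤ r ^ 2 / (r ^ 2 - ‖p‖ ^ 2) ^ 2 := halg
    rw [le_div_iff₀ (by positivity)] at halg'
    rw [one_div, ← div_eq_inv_mul, le_div_iff₀ hsc]
    refine (abs_le_of_sq_le_sq' ?_ hr.le).2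
    rw [mul_pow, Real.sq_sqrt hc.le]
    linarith
  intro z hz
  have hzR : ‖z‖ < R := by simpa using hz
  have hD : 0 < R ^ 2 - ‖z‖ ^ 2 := by nlinarith [norm_nonneg z]
  have step2 : U z * (R ^ 2 - ‖z‖ ^ 2) ≤ 1 / Real.sqrt c * R := by
    have t1 : Tendsto (fun r : ℝ => U z * (r ^ 2 - ‖z‖ ^ 2)) (𝓝[<] R)
        (𝓝 (U z * (R ^ 2 - ‖z‖ ^ 2))) := by
      have : Continuous (fun r : ℝ => U z * (r ^ 2 - ‖z‖ ^ 2)) := by fun_prop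
      exact this.continuousWithinAt
    have t2 : Tendsto (fun r : ℝ => 1 / Real.sqrt c * r) (𝓝[<] R)
        (𝓝 (1 / Real.sqrt c * R)) := by
      have : Continuous (fun r : ℝ => 1 / Real.sqrt c * r) := by fun_prop
      exact this.continuousWithinAt
    refine le_of_tendsto_of_tendsto t1 t2 ?_
    filter_upwards [Ioo_mem_nhdsLT hzR] with r hr
    exact step1 r (lt_of_le_of_lt (norm_nonneg _) hr.1) hr.2 z hr.1.le
  have hNz := hN z hz
  have hX0 : ∀ j, 0 ≤ fujX g h (a j) (b j) z := fun j => div_nonneg (by positivity) hNz.le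
  by_cases hex : ∃ j ∈ J, a j * g z + b j * h z = 0
  · obtain ⟨j, hj, he⟩ := hex
    have hW0 := (fuj_tendsto (hg z hz) (hh z hz) (a j) (b j) (hab j hj) hNz he (m j) (hm j hj)
      (hmo j hj z hz he) (htop j hj z hz) (β j) s le_rfl hs0.le hs1).1
    rw [hW0, norm_zero, zero_div]
    have : 0 ≤ ∏ j ∈ J, fujX g h (a j) (b j) z ^ ((1 - 1 / (m j : ℝ)) * s / 2) :=
      Finset.prod_nonneg fun j _ => Real.rpow_nonneg (hX0 j) _
    positivity
  · push Not at hex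
    have hXp : ∀ j ∈ J, 0 < fujX g h (a j) (b j) z := fun j hj =>
      div_pos (pow_pos (norm_pos_iff.2 (hex j hj)) 2) hNz
    have hP : 0 < ∏ j ∈ J, fujX g h (a j) (b j) z ^ ((1 - 1 / (m j : ℝ)) * s / 2) :=
      Finset.prod_pos fun j hj => Real.rpow_pos_of_pos (hXp j hj) _
    rw [← div_le_iff₀ hP, le_div_iff₀ hD]
    refine le_trans ?_ step2
    refine mul_le_mul_of_nonneg_right ?_ hD.le
    have e : ∏ j ∈ J, fujX g h (a j) (b j) z ^ (-(β j / 2))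
        = (∏ j ∈ J, fujX g h (a j) (b j) z ^ ((1 - 1 / (m j : ℝ)) * s / 2))⁻¹ := by
      rw [← Finset.prod_inv_distrib]
      refine Finset.prod_congr rfl fun j hj => ?_
      rw [Real.rpow_neg (hX0 j)]
    rw [hU]
    unfold fujU
    rw [e, ← div_eq_mul_inv]
    refine le_mul_of_one_le_right (by positivity) (Real.one_le_exp ?_)
    exact mul_nonneg hκ0.le (Finset.sum_nonneg fun j _ => Real.rpow_nonneg (hX0 j) _)

lemma fuj_rpow_half (x t : ℝ) (hx : 0 ≤ x) : (x ^ 2) ^ (t / 2) = x ^ t := by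
  rw [← Real.rpow_natCast, ← Real.rpow_mul hx]
  congr 1
  push_cast; ring

lemma fuj_X_some (g h : ℂ → ℂ) (z α : ℂ) (hz : h z ≠ 0) :
    fujX g h ((Real.sqrt (1 + ‖α‖ ^ 2) : ℂ)⁻¹) ((Real.sqrt (1 + ‖α‖ ^ 2) : ℂ)⁻¹ * (-α)) z
      = chordal (g z / h z) α ^ 2 := by
  have hh : 0 < ‖h z‖ := norm_pos_iff.2 hz
  have hα : 0 < 1 + ‖α‖ ^ 2 := by positivity
  have e1 : (Real.sqrt (1 + ‖α‖ ^ 2) : ℂ)⁻¹ * g z + (Real.sqrt (1 + ‖α‖ ^ 2) : ℂ)⁻¹ * (-α) * h z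
      = (Real.sqrt (1 + ‖α‖ ^ 2) : ℂ)⁻¹ * ((g z / h z - α) * h z) := by
    field_simp
    ring
  unfold fujX fujN chordal
  rw [e1]
  simp only [norm_mul, norm_inv, Complex.norm_real, Real.norm_eq_abs, abs_of_nonneg
    (Real.sqrt_nonneg _), mul_pow, div_pow, inv_pow, Real.sq_sqrt hα.le, norm_div]
  rw [Real.sq_sqrt (by positivity)]
  field_simp
  ring

lemma fuj_X_none (g h : ℂ → ℂ) (z : ℂ) (hz : h z ≠ 0) :
    fujX g h 0 1 z = chordalInf (g z / h z) ^ 2 := by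
  have hh : 0 < ‖h z‖ := norm_pos_iff.2 hz
  unfold fujX fujN chordalInf
  rw [div_pow, Real.sq_sqrt (by positivity)]
  simp only [norm_div]
  simp
  field_simp
  ring

/-- **Fujimoto's gradient estimate** (Corollary 1.4.15 of Fujimoto's book).
A nonconstant meromorphic function `ρ` on the disk `Δ_R` is represented as the
ratio `ρ = g / h` of two holomorphic functions without common zeros (here
`q = n + 1`, `α_q = ∞`; zeros of `g - α_j·h` are the `α_j`-points of `ρ` and
zeros of `h` its poles, with the same multiplicities).  If all `α_j`-points of
`ρ` have multiplicity at least `m_j`, poles have multiplicity at least `m_q`,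
and `γ = ∑ (1 - 1/m_j) > 2`, then for `η ≥ 0`, `δ > 0` with
`γ - 2 > γ(η + δ)` there is a constant `C > 0`, depending only on `γ`, `η`,
`δ` and a positive lower bound `L` for the mutual chordal distances
`|α_i, α_j|`, such that at every non-pole `z`,
`|ρ'| / (1 + |ρ|²) ≤ C·R/(R² - |z|²) · ∏_j |ρ, α_j|^{(1 - 1/m_j)(1-η-δ)}`.
(The product has been moved to the right-hand side to avoid the singular
quotient at the ramification points themselves.) -/
theorem fujimoto_gradient_estimate
    (gam eta del L : ℝ) (hgam : 2 < gam) (heta : 0 ≤ eta) (hdel : 0 < del)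
    (hcond : gam * (eta + del) < gam - 2) (hL : 0 < L) :
    ∃ C : ℝ, 0 < C ∧
      ∀ (n : ℕ) (α : Fin n → ℂ) (m : Fin n → ℕ) (mq : ℕ),
        Function.Injective α → (∀ j, 0 < m j) → 0 < mq →
        gam = (∑ j, (1 - 1 / (m j : ℝ))) + (1 - 1 / (mq : ℝ)) →
        (∀ i j, i ≠ j → L ≤ chordal (α i) (α j)) →
        (∀ i, L ≤ chordalInf (α i)) →
        ∀ (R : ℝ) (h g : ℂ → ℂ), 0 < R →
          DifferentiableOn ℂ h (Metric.ball 0 R) →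
          DifferentiableOn ℂ g (Metric.ball 0 R) →
          (∀ z ∈ Metric.ball (0 : ℂ) R, h z ≠ 0 ∨ g z ≠ 0) →
          (¬ ∃ a b : ℂ, ¬(a = 0 ∧ b = 0) ∧
              ∀ z ∈ Metric.ball (0 : ℂ) R, a * g z + b * h z = 0) →
          (∀ j, ∀ z ∈ Metric.ball (0 : ℂ) R, g z - α j * h z = 0 →
            ∀ k < m j,
              iteratedDerivWithin k (fun w => g w - α j * h w) (Metric.ball 0 R) z = 0) →
          (∀ z ∈ Metric.ball (0 : ℂ) R, h z = 0 →
            ∀ k < mq, iteratedDerivWithin k h (Metric.ball 0 R) z = 0) →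
          ∀ z ∈ Metric.ball (0 : ℂ) R, h z ≠ 0 →
            ‖deriv (fun w => g w / h w) z‖ / (1 + ‖g z / h z‖ ^ 2) ≤
              C * R / (R ^ 2 - ‖z‖ ^ 2) *
                ((∏ j, chordal (g z / h z) (α j) ^
                    ((1 - 1 / (m j : ℝ)) * (1 - eta - del))) *
                  chordalInf (g z / h z) ^ ((1 - 1 / (mq : ℝ)) * (1 - eta - del))) := by
  have hed : eta + del < 1 := by nlinarith
  obtain ⟨C, hC, H⟩ := fuj_core gam (1 - eta - del) L hgam (by linarith) (by linarith)
    (by nlinarith) hL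
  refine ⟨C, hC, ?_⟩
  intro n α m mq _ hm hmq hg hsep hsepInf R h g hR hhd hgd hnz hind hmj hmi z hz hhz
  set c : Fin n → ℂ := fun j => (Real.sqrt (1 + ‖α j‖ ^ 2) : ℂ)⁻¹ with hcdef
  have hsq : ∀ j, 0 < Real.sqrt (1 + ‖α j‖ ^ 2) := fun j => Real.sqrt_pos.2 (by positivity)
  have hc0 : ∀ j, c j ≠ 0 := fun j => inv_ne_zero (by exact_mod_cast (hsq j).ne')
  have hcn : ∀ j, ‖c j‖ = (Real.sqrt (1 + ‖α j‖ ^ 2))⁻¹ := fun j => by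
    simp [hcdef, abs_of_pos (hsq j)]
  set a : Option (Fin n) → ℂ := fun o => o.elim 0 c with ha
  set b : Option (Fin n) → ℂ := fun o => o.elim 1 (fun j => c j * (-α j)) with hb
  set m' : Option (Fin n) → ℕ := fun o => o.elim mq m with hm'
  have hm'0 : ∀ o, 0 < m' o := by rintro (_ | j); exacts [hmq, hm j]
  set J : Finset (Option (Fin n)) := Finset.univ.filter (fun o => 2 ≤ m' o) with hJ
  have hJone : ∀ o, o ∉ J → m' o = 1 := by
    intro o ho
    have h1 : ¬ 2 ≤ m' o := by simpa [hJ] using ho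
    have := hm'0 o
    omega
  have hgA : ∀ z ∈ Metric.ball (0:ℂ) R, AnalyticAt ℂ g z := fun z hz =>
    hgd.analyticAt (Metric.isOpen_ball.mem_nhds hz)
  have hhA : ∀ z ∈ Metric.ball (0:ℂ) R, AnalyticAt ℂ h z := fun z hz =>
    hhd.analyticAt (Metric.isOpen_ball.mem_nhds hz)
  have hab : ∀ o ∈ J, ‖a o‖ ^ 2 + ‖b o‖ ^ 2 = 1 := by
    rintro (_ | j) _
    · simp [ha, hb]
    · have hp : 0 < 1 + ‖α j‖ ^ 2 := by positivity
      simp only [ha, hb, Option.elim, norm_mul, norm_neg, hcn, mul_pow, inv_pow,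
        Real.sq_sqrt hp.le]
      field_simp
  have hsum : ∑ o ∈ J, (1 - 1 / (m' o : ℝ)) = gam := by
    have e : ∑ o ∈ J, (1 - 1 / (m' o : ℝ)) = ∑ o, (1 - 1 / (m' o : ℝ)) := by
      refine Finset.sum_subset (Finset.subset_univ _) fun o _ ho => ?_
      simp [hJone o ho]
    rw [e, Fintype.sum_option, hg]
    simp only [hm', Option.elim]
    ring
  have hsep' : ∀ i ∈ J, ∀ j ∈ J, i ≠ j → L ≤ ‖a i * b j - a j * b i‖ := by
    rintro (_ | i) _ (_ | j) _ hij
    · exact absurd rfl hij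
    · simpa [ha, hb, hcn, chordalInf] using hsepInf j
    · simpa [ha, hb, hcn, chordalInf] using hsepInf i
    · have hij' : i ≠ j := fun e => hij (by rw [e])
      refine (hsep i j hij').trans (le_of_eq ?_)
      have e : a (some i) * b (some j) - a (some j) * b (some i)
          = c i * c j * (α i - α j) := by
        simp only [ha, hb, Option.elim]; ring
      rw [e, norm_mul, norm_mul, hcn, hcn, chordal]
      have := hsq i; have := hsq j
      field_simp
  have hNp : ∀ z ∈ Metric.ball (0:ℂ) R, 0 < fujN g h z := by
    intro z hz
    unfold fujN
    rcases hnz z hz with h1 | h1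
    · have : 0 < ‖h z‖ := norm_pos_iff.2 h1
      positivity
    · have : 0 < ‖g z‖ := norm_pos_iff.2 h1
      positivity
  have hFsome : ∀ j z, a (some j) * g z + b (some j) * h z = c j * (g z - α j * h z) := by
    intro j z; simp only [ha, hb, Option.elim]; ring
  have hFnone : ∀ z, a none * g z + b none * h z = h z := by
    intro z; simp [ha, hb]
  have hmo : ∀ o ∈ J, ∀ z ∈ Metric.ball (0:ℂ) R, a o * g z + b o * h z = 0 →
      (m' o : ℕ∞) ≤ analyticOrderAt (fun z => a o * g z + b o * h z) z := by
    rintro (_ | j) _ z hz h0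
    · rw [hFnone] at h0
      simp only [hFnone]
      refine (natCast_le_analyticOrderAt_iff_iteratedDeriv_eq_zero (hhA z hz)).2 fun k hk => ?_
      have := hmi z hz h0 k hk
      rwa [iteratedDerivWithin_of_isOpen Metric.isOpen_ball hz] at this
    · rw [hFsome] at h0
      have h0' : g z - α j * h z = 0 := (mul_eq_zero.1 h0).resolve_left (hc0 j)
      simp only [hFsome]
      have hgz := hgA z hz
      have hhz := hhA z hz
      refine (natCast_le_analyticOrderAt_iff_iteratedDeriv_eq_zero (by fun_prop)).2 fun k hk => ?_
      have := hmj j z hz h0' k hk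
      rw [iteratedDerivWithin_of_isOpen Metric.isOpen_ball hz] at this
      rw [iteratedDeriv_const_mul_field, this, mul_zero]
  have htop : ∀ o ∈ J, ∀ z ∈ Metric.ball (0:ℂ) R,
      analyticOrderAt (fun z => a o * g z + b o * h z) z ≠ ⊤ := by
    intro o ho z hz ht
    rw [analyticOrderAt_eq_top] at ht
    have hFA : AnalyticOnNhd ℂ (fun z => a o * g z + b o * h z) (Metric.ball 0 R) := by
      intro y hy
      have := hgA y hy; have := hhA y hy
      fun_prop
    have hz0 := hFA.eqOn_zero_of_preconnected_of_eventuallyEq_zero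
      (convex_ball (0:ℂ) R).isPreconnected hz ht
    refine hind ⟨a o, b o, ?_, fun y hy => hz0 hy⟩
    rintro ⟨h1, h2⟩
    have := hab o ho
    rw [h1, h2] at this
    simp at this
  have key := H (Option (Fin n)) J a b m' hab (fun o ho => by simpa [hJ] using ho) hsum hsep' R g h
    hR hgA hhA hNp hmo htop z hz
  have hh0 : 0 < ‖h z‖ := norm_pos_iff.2 hhz
  have hlhs : ‖deriv (fun w => g w / h w) z‖ / (1 + ‖g z / h z‖ ^ 2)
      = ‖fujW g h z‖ / fujN g h z := by
    rw [deriv_fun_div (hgA z hz).differentiableAt (hhA z hz).differentiableAt hhz]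
    unfold fujW fujN
    simp only [norm_div, norm_pow]
    field_simp
    ring
  have hprod : ∏ o ∈ J, fujX g h (a o) (b o) z ^ ((1 - 1 / (m' o : ℝ)) * (1 - eta - del) / 2)
      = (∏ j, chordal (g z / h z) (α j) ^ ((1 - 1 / (m j : ℝ)) * (1 - eta - del))) *
        chordalInf (g z / h z) ^ ((1 - 1 / (mq : ℝ)) * (1 - eta - del)) := by
    have e : ∏ o ∈ J, fujX g h (a o) (b o) z ^ ((1 - 1 / (m' o : ℝ)) * (1 - eta - del) / 2)
        = ∏ o, fujX g h (a o) (b o) z ^ ((1 - 1 / (m' o : ℝ)) * (1 - eta - del) / 2) := by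
      refine Finset.prod_subset (Finset.subset_univ _) fun o _ ho => ?_
      simp [hJone o ho]
    rw [e, Fintype.prod_option, mul_comm]
    congr 1
    · refine Finset.prod_congr rfl fun j _ => ?_
      have : fujX g h (a (some j)) (b (some j)) z = chordal (g z / h z) (α j) ^ 2 :=
        fuj_X_some g h z (α j) hhz
      rw [this]
      exact fuj_rpow_half _ _ (by unfold chordal; positivity)
    · have : fujX g h (a none) (b none) z = chordalInf (g z / h z) ^ 2 :=
        fuj_X_none g h z hhz
      rw [this]
      exact fuj_rpow_half _ _ (by unfold chordalInf; positivity)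
  rw [hlhs, ← hprod]
  exact key
end

section
/- Let U ⊆ ℂ be a nonempty open connected set and let u : U → (0, ∞) be a smooth function such that log u is harmonic on U (so that dσ² = u(z)|dz|² is a flat conformal metric on U). Then for each point p ∈ U there exist R ∈ (0, +∞], a holomorphic map Φ : Δ_R = {z ∈ ℂ : |z| < R} → U with Φ(0) = p satisfying |Φ'(z)|² · u(Φ(z)) = 1 for all z ∈ Δ_R (so Φ is a local isometry from the Euclidean metric on Δ_R to dσ², and in particular a local diffeomorphism), and a complex number a₀ with |a₀| = 1 such that the curve s ↦ Φ(a₀·s), s ∈ [0, R), is divergent in U, i.e. for every compact set K ⊆ U there exists s₀ ∈ [0, R) with Φ(a₀·s) ∉ K for all s > s₀. -/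
open scoped ENNReal

/-- A twice-differentiable real function is harmonic on an open set `U ⊆ ℂ`
when its Laplacian `f_xx + f_yy` vanishes there. -/
def HarmonicOnC (f : ℂ → ℝ) (U : Set ℂ) : Prop :=
  ∀ z ∈ U,
    fderiv ℝ (fun w => fderiv ℝ f w 1) z 1 +
      fderiv ℝ (fun w => fderiv ℝ f w Complex.I) z Complex.I = 0

open Filter Topology Metric Set

/-- `f` is a holomorphic local isometry at `z`, with value in `U`. -/
def IsoAt (U : Set ℂ) (u : ℂ → ℝ) (f : ℂ → ℂ) (z : ℂ) : Prop :=
  DifferentiableAt ℂ f z ∧ f z ∈ U ∧ ‖deriv f z‖ ^ 2 * u (f z) = 1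

lemma IsoAt.congr {U : Set ℂ} {u : ℂ → ℝ} {f g : ℂ → ℂ} {z : ℂ} (h : IsoAt U u f z)
    (hfg : g =ᶠ[𝓝 z] f) : IsoAt U u g z := by
  obtain ⟨h1, h2, h3⟩ := h
  refine ⟨h1.congr_of_eventuallyEq hfg, ?_, ?_⟩
  · rw [hfg.eq_of_nhds]; exact h2
  · rw [hfg.deriv_eq, hfg.eq_of_nhds]; exact h3

lemma IsoAt.deriv_ne {U : Set ℂ} {u : ℂ → ℝ} {f : ℂ → ℂ} {z : ℂ} (h : IsoAt U u f z) :
    deriv f z ≠ 0 := by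
  intro h0
  have := h.2.2
  simp [h0] at this

/-- Precomposition with a Euclidean motion. -/
lemma IsoAt.motion {U : Set ℂ} {u : ℂ → ℝ} {f : ℂ → ℂ} {a b l z : ℂ} (hl : ‖l‖ = 1)
    (h : IsoAt U u f (a + l * (z - b))) :
    IsoAt U u (fun z => f (a + l * (z - b))) z ∧
      deriv (fun z => f (a + l * (z - b))) z = deriv f (a + l * (z - b)) * l := by
  have h1 : HasDerivAt (fun z : ℂ => a + l * (z - b)) l z := by
    simpa using (((hasDerivAt_id z).sub_const b).const_mul l).const_add a
  have h2 : HasDerivAt (fun z => f (a + l * (z - b))) (deriv f (a + l * (z - b)) * l) z :=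
    h.1.hasDerivAt.comp z h1
  refine ⟨⟨h2.differentiableAt, h.2.1, ?_⟩, h2.deriv⟩
  rw [h2.deriv, norm_mul, hl, mul_one]
  exact h.2.2

lemma harmonic_bridge (U : Set ℂ) (hop : IsOpen U)
    (u : ℂ → ℝ) (hpos : ∀ z ∈ U, 0 < u z) (hsm : ContDiffOn ℝ ((⊤ : ℕ∞) : WithTop ℕ∞) u U)
    (hflat : HarmonicOnC (fun z => Real.log (u z)) U) :
    InnerProductSpace.HarmonicOnNhd (fun z => Real.log (u z)) U := by
  have hc : ∀ z ∈ U, ContDiffAt ℝ 2 (fun z => Real.log (u z)) z := fun z hz =>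
    ((hsm.contDiffAt (hop.mem_nhds hz)).of_le (by norm_cast)).log (hpos z hz).ne'
  intro z hz
  refine ⟨hc z hz, ?_⟩
  filter_upwards [hop.mem_nhds hz] with w hw
  have hd : DifferentiableAt ℝ (fderiv ℝ (fun z => Real.log (u z))) w :=
    ((hc w hw).fderiv_right (m := 1) (by norm_num)).differentiableAt (by norm_num)
  have key : ∀ v : ℂ, fderiv ℝ (fun w => fderiv ℝ (fun z => Real.log (u z)) w v) w v
      = fderiv ℝ (fderiv ℝ (fun z => Real.log (u z))) w v v := by
    intro v
    rw [fderiv_clm_apply hd (differentiableAt_const v)]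
    simp
  have := hflat w hw
  rw [key, key] at this
  rw [InnerProductSpace.laplacian_eq_iteratedFDeriv_complexPlane]
  simpa [iteratedFDeriv_two_apply] using this

lemma exists_developing (U : Set ℂ) (hop : IsOpen U)
    (u : ℂ → ℝ) (hpos : ∀ z ∈ U, 0 < u z)
    (hh : InnerProductSpace.HarmonicOnNhd (fun z => Real.log (u z)) U) (q : ℂ) (hq : q ∈ U) :
    ∃ (G : ℂ → ℂ) (r : ℝ), 0 < r ∧ ball q r ⊆ U ∧
      ∀ w ∈ ball q r, DifferentiableAt ℂ G w ∧ ‖deriv G w‖ ^ 2 = u w := by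
  obtain ⟨r, hr, hrU⟩ := Metric.isOpen_iff.1 hop q hq
  obtain ⟨F, hF, hFu⟩ := (hh.mono hrU).exists_analyticOnNhd_ball_re_eq
  have hd : DifferentiableOn ℂ (fun z => Complex.exp (F z / 2)) (ball q r) :=
    (hF.differentiableOn.div_const 2).cexp
  obtain ⟨G, hG⟩ := hd.isExactOn_ball
  refine ⟨G, r, hr, hrU, fun w hw => ⟨(hG w hw).differentiableAt, ?_⟩⟩
  rw [(hG w hw).deriv, Complex.norm_exp, ← Real.exp_nat_mul]
  have h1 : (F w).re = Real.log (u w) := hFu hw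
  have h2 : (F w / 2).re = (F w).re / 2 := by
    rw [show (2 : ℂ) = ((2 : ℝ) : ℂ) by simp, Complex.div_ofReal_re]
  rw [h2, h1]
  rw [show ((2 : ℕ) : ℝ) * (Real.log (u w) / 2) = Real.log (u w) by push_cast; ring]
  exact Real.exp_log (hpos w (hrU hw))

/-- The developing map as an open partial homeomorphism. -/
lemma exists_chart (U : Set ℂ) (hop : IsOpen U)
    (u : ℂ → ℝ) (hpos : ∀ z ∈ U, 0 < u z)
    (hh : InnerProductSpace.HarmonicOnNhd (fun z => Real.log (u z)) U) (q : ℂ) (hq : q ∈ U) :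
    ∃ e : OpenPartialHomeomorph ℂ ℂ, q ∈ e.source ∧ e.source ⊆ U ∧
      ∀ w ∈ e.source, DifferentiableAt ℂ e w ∧ ‖deriv e w‖ ^ 2 = u w := by
  obtain ⟨G, r, hr, hrU, hG⟩ := exists_developing U hop u hpos hh q hq
  have han : AnalyticAt ℂ G q := DifferentiableOn.analyticAt (s := ball q r)
    (fun w hw => (hG w hw).1.differentiableWithinAt) (ball_mem_nhds q hr)
  have hs : HasStrictDerivAt G (deriv G q) q := han.hasStrictDerivAt
  have hne : deriv G q ≠ 0 := by
    intro h0
    have h1 := (hG q (mem_ball_self hr)).2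
    have h2 := hpos q hq
    rw [h0] at h1
    simp at h1
    linarith
  let e := (hs.hasStrictFDerivAt_equiv hne).toOpenPartialHomeomorph G
  have he : ⇑e = G := (hs.hasStrictFDerivAt_equiv hne).toOpenPartialHomeomorph_coe
  have hes : q ∈ e.source := (hs.hasStrictFDerivAt_equiv hne).mem_toOpenPartialHomeomorph_source
  refine ⟨e.restrOpen (ball q r) isOpen_ball, ?_, ?_, ?_⟩
  · simp [hes, hr]
  · intro w hw
    simp at hw
    exact hrU hw.2
  · intro w hw
    simp at hw
    have : ⇑(e.restrOpen (ball q r) isOpen_ball) = G := by simpa using he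
    rw [this]
    exact hG w hw.2

/-- Uniqueness of germs of local isometries. -/
lemma germ_unique (U : Set ℂ) (hop : IsOpen U)
    (u : ℂ → ℝ) (hpos : ∀ z ∈ U, 0 < u z)
    (hh : InnerProductSpace.HarmonicOnNhd (fun z => Real.log (u z)) U)
    (f g : ℂ → ℂ) (z₀ : ℂ) (hf : ∀ᶠ z in 𝓝 z₀, IsoAt U u f z)
    (hg : ∀ᶠ z in 𝓝 z₀, IsoAt U u g z) (h0 : f z₀ = g z₀) (h1 : deriv f z₀ = deriv g z₀) :
    f =ᶠ[𝓝 z₀] g := by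
  obtain ⟨e, hq, heU, he⟩ := exists_chart U hop u hpos hh (f z₀) hf.self_of_nhds.2.1
  have aux : ∀ f : ℂ → ℂ, (∀ᶠ z in 𝓝 z₀, IsoAt U u f z) → f z₀ ∈ e.source →
      ∀ᶠ z in 𝓝 z₀, IsoAt U u f z ∧ f z ∈ e.source := by
    intro f hf hfe
    exact hf.and (hf.self_of_nhds.1.continuousAt.eventually (e.open_source.mem_nhds hfe))
  obtain ⟨ρ, hρ, hball⟩ := Metric.eventually_nhds_iff_ball.1
    ((aux f hf hq).and (aux g hg (h0 ▸ hq)))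
  have aux2 : ∀ f : ℂ → ℂ, (∀ z ∈ ball z₀ ρ, IsoAt U u f z ∧ f z ∈ e.source) →
      DifferentiableOn ℂ (e ∘ f) (ball z₀ ρ) ∧
      EqOn (deriv (e ∘ f)) (fun _ => deriv e (f z₀) * deriv f z₀) (ball z₀ ρ) := by
    intro f hf
    have hd : ∀ z ∈ ball z₀ ρ, HasDerivAt (e ∘ f) (deriv e (f z) * deriv f z) z := fun z hz =>
      (he _ (hf z hz).2).1.hasDerivAt.comp z (hf z hz).1.1.hasDerivAt
    have hdo : DifferentiableOn ℂ (e ∘ f) (ball z₀ ρ) := fun z hz =>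
      (hd z hz).differentiableAt.differentiableWithinAt
    have hn : ∀ z ∈ ball z₀ ρ, ‖deriv (e ∘ f) z‖ = 1 := by
      intro z hz
      rw [(hd z hz).deriv, norm_mul]
      have a1 := (he _ (hf z hz).2).2
      have a2 := (hf z hz).1.2.2
      rw [← a1, ← mul_pow] at a2
      rw [mul_comm]
      exact (pow_eq_one_iff_of_nonneg (by positivity) (by norm_num)).1 a2
    refine ⟨hdo, ?_⟩
    have := Complex.eqOn_of_isPreconnected_of_isMaxOn_norm (f := deriv (e ∘ f))
      (convex_ball z₀ ρ).isPreconnected isOpen_ball (hdo.deriv isOpen_ball) (mem_ball_self hρ)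
      (fun z hz => by simp [hn z hz, hn z₀ (mem_ball_self hρ)])
    intro z hz
    rw [this hz, Function.const_apply, (hd z₀ (mem_ball_self hρ)).deriv]
  obtain ⟨f1, f2⟩ := aux2 f (fun z hz => (hball z hz).1)
  obtain ⟨g1, g2⟩ := aux2 g (fun z hz => (hball z hz).2)
  have heq : EqOn (e ∘ f) (e ∘ g) (ball z₀ ρ) := by
    refine isOpen_ball.eqOn_of_deriv_eq (convex_ball z₀ ρ).isPreconnected f1 g1 ?_
      (mem_ball_self hρ) (by simp [h0])
    intro z hz
    rw [f2 hz, g2 hz, h0, h1]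
  filter_upwards [ball_mem_nhds z₀ hρ] with z hz
  exact e.injOn (hball z hz).1.2 (hball z hz).2.2 (heq hz)

lemma iso_analytic {U : Set ℂ} {u : ℂ → ℝ} {f : ℂ → ℂ} {s : Set ℂ} (hs : IsOpen s)
    (h : ∀ z ∈ s, IsoAt U u f z) : AnalyticOnNhd ℂ f s :=
  DifferentiableOn.analyticOnNhd (fun z hz => (h z hz).1.differentiableWithinAt) hs

/-- Existence of local isometries. -/
lemma exists_normal (U : Set ℂ) (hop : IsOpen U)
    (u : ℂ → ℝ) (hpos : ∀ z ∈ U, 0 < u z)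
    (hh : InnerProductSpace.HarmonicOnNhd (fun z => Real.log (u z)) U) (q : ℂ) (hq : q ∈ U) :
    ∃ (f : ℂ → ℂ) (r : ℝ), 0 < r ∧ f 0 = q ∧ ∀ z ∈ ball (0 : ℂ) r, IsoAt U u f z := by
  obtain ⟨e, hqs, heU, he⟩ := exists_chart U hop u hpos hh q hq
  obtain ⟨r, hr, hrt⟩ := Metric.isOpen_iff.1 e.open_target (e q) (e.map_source hqs)
  have key : ∀ y ∈ ball (e q) r, IsoAt U u e.symm y := by
    intro y hy
    have hyt := hrt hy
    have hs := e.map_target hyt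
    obtain ⟨d1, d2⟩ := he _ hs
    have hup := hpos _ (heU hs)
    have hne : deriv e (e.symm y) ≠ 0 := by
      intro h0
      rw [h0] at d2
      simp at d2
      linarith
    have hd := e.hasDerivAt_symm hyt hne d1.hasDerivAt
    refine ⟨hd.differentiableAt, heU hs, ?_⟩
    rw [hd.deriv, norm_inv, ← d2]
    have : ‖deriv e (e.symm y)‖ ≠ 0 := by simpa using hne
    field_simp
  refine ⟨fun z => e.symm (e q + 1 * (z - 0)), r, hr, by simp [e.left_inv hqs], ?_⟩
  intro z hz
  exact (IsoAt.motion (by simp) (key _ (by simpa using hz))).1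

/-- Extension lemma: germs of local isometries with value near `q` extend to balls of
a fixed radius, and the extension attains `q`. -/
lemma exists_ext (U : Set ℂ) (hop : IsOpen U)
    (u : ℂ → ℝ) (hpos : ∀ z ∈ U, 0 < u z)
    (hh : InnerProductSpace.HarmonicOnNhd (fun z => Real.log (u z)) U) (q : ℂ) (hq : q ∈ U) :
    ∃ r : ℝ, 0 < r ∧ ∃ N ∈ 𝓝 q, ∀ (f : ℂ → ℂ) (z₀ : ℂ), (∀ᶠ z in 𝓝 z₀, IsoAt U u f z) →
      f z₀ ∈ N → ∃ g : ℂ → ℂ, (∀ z ∈ ball z₀ r, IsoAt U u g z) ∧ g =ᶠ[𝓝 z₀] f ∧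
        ∃ w ∈ ball z₀ r, g w = q := by
  obtain ⟨p, r, hr, hp0, hp⟩ := exists_normal U hop u hpos hh q hq
  refine ⟨r / 2, by positivity, p '' ball 0 (r / 2), ?_, ?_⟩
  · have hs : HasStrictDerivAt p (deriv p 0) 0 :=
      (iso_analytic isOpen_ball hp 0 (mem_ball_self hr)).hasStrictDerivAt
    rw [← hp0, ← hs.map_nhds_eq (hp 0 (mem_ball_self hr)).deriv_ne]
    exact image_mem_map (ball_mem_nhds 0 (by positivity))
  · rintro f z₀ hf ⟨w, hw, hfw⟩
    have hw' : ‖w‖ < r / 2 := by simpa using hw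
    have hpw : IsoAt U u p w := hp w (by simp; linarith)
    have hf0 := hf.self_of_nhds
    have hne := hpw.deriv_ne
    set l := deriv f z₀ / deriv p w with hl
    have hl1 : ‖l‖ = 1 := by
      have a1 := hf0.2.2
      have a2 := hpw.2.2
      rw [← hfw] at a1
      have hu : u (p w) ≠ 0 := (hpos _ hpw.2.1).ne'
      have a3 : ‖deriv f z₀‖ ^ 2 = ‖deriv p w‖ ^ 2 :=
        mul_right_cancel₀ hu (a1.trans a2.symm)
      have a4 : ‖deriv f z₀‖ = ‖deriv p w‖ := (sq_eq_sq₀ (norm_nonneg _) (norm_nonneg _)).1 a3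
      rw [hl, norm_div, a4, div_self (by simpa using hne)]
    have hlne : l ≠ 0 := by
      intro h; simp [h] at hl1
    have hg : ∀ z ∈ ball z₀ (r / 2), IsoAt U u (fun z => p (w + l * (z - z₀))) z ∧
      deriv (fun z => p (w + l * (z - z₀))) z = deriv p (w + l * (z - z₀)) * l := by
      intro z hz
      refine IsoAt.motion hl1 (hp _ ?_)
      rw [mem_ball_iff_norm] at hz
      have : ‖w + l * (z - z₀)‖ ≤ ‖w‖ + ‖z - z₀‖ := by
        refine (norm_add_le _ _).trans ?_
        rw [norm_mul, hl1, one_mul]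
      simp; linarith
    have hz0 : z₀ ∈ ball z₀ (r / 2) := mem_ball_self (by positivity)
    refine ⟨fun z => p (w + l * (z - z₀)), fun z hz => (hg z hz).1, ?_, ?_⟩
    · refine germ_unique U hop u hpos hh _ _ _ ?_ hf (by simp [hfw]) ?_
      · filter_upwards [ball_mem_nhds z₀ (half_pos hr)] with z hz using (hg z hz).1
      · rw [(hg z₀ hz0).2]
        simp only [sub_self, mul_zero, add_zero, hl]
        field_simp
    · refine ⟨z₀ - l⁻¹ * w, ?_, ?_⟩
      · simp [mem_ball_iff_norm, hl1]; exact hw'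
      · have : w + l * (z₀ - l⁻¹ * w - z₀) = 0 := by field_simp; ring
        simp only [this, hp0]

/-- Two local isometries agreeing near a point agree on a common connected domain. -/
lemma iso_eqOn {U : Set ℂ} {u : ℂ → ℝ} {f g : ℂ → ℂ} {s : Set ℂ} (hs : IsOpen s)
    (hc : IsPreconnected s) (hf : ∀ z ∈ s, IsoAt U u f z) (hg : ∀ z ∈ s, IsoAt U u g z)
    {z₀ : ℂ} (hz : z₀ ∈ s) (h : f =ᶠ[𝓝 z₀] g) : EqOn f g s :=
  (iso_analytic hs hf).eqOn_of_preconnected_of_eventuallyEq (iso_analytic hs hg) hc hz h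

lemma entire_period (U : Set ℂ) (hop : IsOpen U)
    (u : ℂ → ℝ) (hpos : ∀ z ∈ U, 0 < u z)
    (hh : InnerProductSpace.HarmonicOnNhd (fun z => Real.log (u z)) U)
    (P : ℂ → ℂ) (hP : ∀ z, IsoAt U u P z) (z₁ z₂ : ℂ) (h12 : P z₁ = P z₂) :
    Function.Periodic P (z₂ - z₁) := by
  have hne := (hP z₂).deriv_ne
  set l := deriv P z₁ / deriv P z₂ with hl
  have hl1 : ‖l‖ = 1 := by
    have a1 := (hP z₁).2.2
    have a2 := (hP z₂).2.2
    rw [h12] at a1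
    have hu : u (P z₂) ≠ 0 := (hpos _ (hP z₂).2.1).ne'
    have a3 : ‖deriv P z₁‖ ^ 2 = ‖deriv P z₂‖ ^ 2 :=
      mul_right_cancel₀ hu (a1.trans a2.symm)
    have a4 : ‖deriv P z₁‖ = ‖deriv P z₂‖ := (sq_eq_sq₀ (norm_nonneg _) (norm_nonneg _)).1 a3
    rw [hl, norm_div, a4, div_self (by simpa using hne)]
  have hm : ∀ z, IsoAt U u (fun z => P (z₂ + l * (z - z₁))) z ∧
      deriv (fun z => P (z₂ + l * (z - z₁))) z = deriv P (z₂ + l * (z - z₁)) * l :=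
    fun z => IsoAt.motion hl1 (hP _)
  have hgerm : (fun z => P (z₂ + l * (z - z₁))) =ᶠ[𝓝 z₁] P := by
    refine germ_unique U hop u hpos hh _ _ _ (Eventually.of_forall fun z => (hm z).1)
      (Eventually.of_forall hP) (by simp [h12]) ?_
    rw [(hm z₁).2]
    simp only [sub_self, mul_zero, add_zero, hl]
    field_simp
  have heq : (fun z => P (z₂ + l * (z - z₁))) = P := by
    funext z
    exact iso_eqOn isOpen_univ isPreconnected_univ (fun z _ => (hm z).1) (fun z _ => hP z)
      (mem_univ z₁) hgerm (mem_univ z)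
  have hl2 : l = 1 := by
    by_contra hl2
    have h1l : 1 - l ≠ 0 := fun h => hl2 (sub_eq_zero.1 h).symm
    set w := (z₂ - l * z₁) / (1 - l) with hw
    have hfix : z₂ + l * (w - z₁) = w := by
      rw [hw]; field_simp; ring
    have h2 := (hm w).2
    rw [heq, hfix] at h2
    have h3 := (hP w).deriv_ne
    apply hl2
    exact (mul_left_cancel₀ h3 ((mul_one _).trans h2)).symm
  intro z
  have h4 := congrFun heq z
  simp only [hl2, one_mul] at h4
  rw [← h4]
  congr 1
  ring

lemma entire_direction (U : Set ℂ) (u : ℂ → ℝ)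
    (P : ℂ → ℂ) (hP : ∀ z, IsoAt U u P z) :
    ∃ a : ℂ, ‖a‖ = 1 ∧ ∀ c, Function.Periodic P c → (c * (starRingEnd ℂ) a).re = 0 := by
  by_cases h : ∀ c, Function.Periodic P c → c = 0
  · exact ⟨1, by simp, fun c hc => by simp [h c hc]⟩
  push Not at h
  obtain ⟨c₀, hc₀, hne⟩ := h
  have hn : (‖c₀‖ : ℂ) ≠ 0 := by simpa using hne
  refine ⟨Complex.I * c₀ / ‖c₀‖, ?_, ?_⟩
  · simp [hne]
  intro c hc
  by_contra hre
  -- real determinant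
  have hdet : c.re * c₀.im - c.im * c₀.re ≠ 0 := by
    intro h0
    apply hre
    have : (c * (starRingEnd ℂ) (Complex.I * c₀ / ‖c₀‖)) =
        (c * (starRingEnd ℂ) (Complex.I * c₀)) / ((‖c₀‖ : ℝ) : ℂ) := by
      simp [mul_div_assoc]; ring
    rw [this, Complex.div_ofReal_re]
    have : (c * (starRingEnd ℂ) (Complex.I * c₀)).re = 0 := by
      simp
      linarith
    rw [this, zero_div]
  set D := c.re * c₀.im - c.im * c₀.re with hD
  have hrep : ∀ z : ℂ, ∃ x y : ℝ, z = x * c + y * c₀ := by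
    intro z
    refine ⟨(z.re * c₀.im - z.im * c₀.re) / D, (c.re * z.im - c.im * z.re) / D, ?_⟩
    apply Complex.ext
    · simp; field_simp; rw [hD]; ring
    · simp; field_simp; rw [hD]; ring
  have hcont : Continuous P := continuous_iff_continuousAt.2 fun z => (hP z).1.continuousAt
  have hcomp : IsCompact ((fun t : ℝ × ℝ => P (t.1 * c + t.2 * c₀)) '' (Icc 0 1 ×ˢ Icc 0 1)) := by
    refine (isCompact_Icc.prod isCompact_Icc).image ?_
    fun_prop
  have hb : Bornology.IsBounded (range P) := by
    refine hcomp.isBounded.subset ?_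
    rintro _ ⟨z, rfl⟩
    obtain ⟨x, y, rfl⟩ := hrep z
    refine ⟨(Int.fract x, Int.fract y), ⟨⟨Int.fract_nonneg _, (Int.fract_lt_one _).le⟩,
      ⟨Int.fract_nonneg _, (Int.fract_lt_one _).le⟩⟩, ?_⟩
    have h1 := (hc.int_mul ⌊x⌋)
    have h2 := (hc₀.int_mul ⌊y⌋)
    have h3 : (x : ℂ) * c + y * c₀ =
        ((Int.fract x : ℝ) * c + (Int.fract y : ℝ) * c₀) + (⌊x⌋ : ℂ) * c + (⌊y⌋ : ℂ) * c₀ := by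
      have e1 : (x : ℂ) = ((Int.fract x : ℝ) : ℂ) + (⌊x⌋ : ℂ) := by
        exact_mod_cast (Int.fract_add_floor x).symm
      have e2 : (y : ℂ) = ((Int.fract y : ℝ) : ℂ) + (⌊y⌋ : ℂ) := by
        exact_mod_cast (Int.fract_add_floor y).symm
      conv_lhs => rw [e1, e2]
      ring
    rw [h3, h2, h1]
  have hdiff : Differentiable ℂ P := fun z => (hP z).1
  have hconst : P = fun _ => P 0 := by
    funext z
    exact hdiff.apply_eq_apply_of_bounded hb z 0
  apply (hP 0).deriv_ne
  rw [hconst]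
  simp

lemma entire_case (U : Set ℂ) (hop : IsOpen U)
    (u : ℂ → ℝ) (hpos : ∀ z ∈ U, 0 < u z)
    (hh : InnerProductSpace.HarmonicOnNhd (fun z => Real.log (u z)) U)
    (P : ℂ → ℂ) (hP : ∀ z, IsoAt U u P z) :
    ∃ a : ℂ, ‖a‖ = 1 ∧ ∀ K ⊆ U, IsCompact K → ∃ s₀ : ℝ, 0 ≤ s₀ ∧
      ∀ s : ℝ, s₀ < s → P (a * s) ∉ K := by
  obtain ⟨a, ha, hper⟩ := entire_direction U u P hP
  refine ⟨a, ha, fun K hKU hK => ?_⟩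
  by_contra hcon
  push Not at hcon
  have hfreq : ∃ᶠ s : ℝ in atTop, P (a * s) ∈ K := by
    rw [frequently_atTop]
    intro b
    obtain ⟨s, hs, hsK⟩ := hcon (max b 0) (le_max_right _ _)
    exact ⟨s, (le_max_left _ _).trans hs.le, hsK⟩
  obtain ⟨q, hqK, hq⟩ := hK.exists_mapClusterPt_of_frequently hfreq
  obtain ⟨r, hr, N, hN, hext⟩ := exists_ext U hop u hpos hh q (hKU hqK)
  have hfr : ∃ᶠ s : ℝ in atTop, P (a * s) ∈ N := hq.frequently hN
  have hpre : ∀ s : ℝ, P (a * s) ∈ N → ∃ w ∈ ball (a * (s : ℂ)) r, P w = q := by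
    intro s hs
    obtain ⟨g, hg, hgP, w, hw, hgw⟩ := hext P (a * s) (Eventually.of_forall hP) hs
    refine ⟨w, hw, ?_⟩
    rw [← hgw]
    exact (iso_eqOn isOpen_ball (convex_ball _ _).isPreconnected hg (fun z _ => hP z)
      (mem_ball_self hr) hgP hw).symm
  rw [frequently_atTop] at hfr
  obtain ⟨s, -, hs⟩ := hfr 0
  obtain ⟨t, hst, ht⟩ := hfr (s + 2 * r)
  obtain ⟨w, hw, hPw⟩ := hpre s hs
  obtain ⟨v, hv, hPv⟩ := hpre t ht
  have h0 := hper _ (entire_period U hop u hpos hh P hP w v (hPw.trans hPv.symm))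
  rw [mem_ball_iff_norm] at hw hv
  have haa : a * (starRingEnd ℂ) a = 1 := by
    rw [Complex.mul_conj, Complex.normSq_eq_norm_sq, ha]; simp
  have hdec : (v - w) * (starRingEnd ℂ) a = ((t - s : ℝ) : ℂ)
      + ((v - a * t) - (w - a * s)) * (starRingEnd ℂ) a := by
    push_cast
    linear_combination (t - s : ℂ) * haa
  rw [hdec, Complex.add_re, Complex.ofReal_re] at h0
  have hle : |(((v - a * t) - (w - a * s)) * (starRingEnd ℂ) a).re|
      ≤ ‖v - a * t‖ + ‖w - a * s‖ := by
    refine (Complex.abs_re_le_norm _).trans ?_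
    rw [norm_mul, Complex.norm_conj, ha, mul_one]
    exact norm_sub_le _ _
  have := (abs_le.1 hle).1
  linarith

lemma disc_case (U : Set ℂ) (hop : IsOpen U)
    (u : ℂ → ℝ) (hpos : ∀ z ∈ U, 0 < u z)
    (hh : InnerProductSpace.HarmonicOnNhd (fun z => Real.log (u z)) U)
    (R : ℝ) (hR : 0 < R) (P : ℂ → ℂ) (hP : ∀ z ∈ ball (0 : ℂ) R, IsoAt U u P z)
    (hnd : ∀ a : ℂ, ‖a‖ = 1 → ∃ K ⊆ U, IsCompact K ∧ ∃ᶠ s : ℝ in 𝓝[<] R, P (a * s) ∈ K) :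
    ∃ R' : ℝ, R < R' ∧ ∃ g : ℂ → ℂ, (∀ z ∈ ball (0 : ℂ) R', IsoAt U u g z) ∧ g =ᶠ[𝓝 0] P := by
  -- local extension around each point of the closed ball
  have hloc : ∀ x : ℂ, x ∈ closedBall (0 : ℂ) R → ∃ s : Set ℂ, ∃ g : ℂ → ℂ,
      IsOpen s ∧ x ∈ s ∧ Convex ℝ s ∧ (∀ z ∈ s, IsoAt U u g z) ∧ EqOn g P (s ∩ ball 0 R) := by
    intro x hx
    rcases lt_or_eq_of_le (show ‖x‖ ≤ R by simpa using hx) with hlt | heq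
    · exact ⟨ball 0 R, P, isOpen_ball, by simpa using hlt, convex_ball _ _, hP, fun z _ => rfl⟩
    · have hRc : (R : ℂ) ≠ 0 := by exact_mod_cast hR.ne'
      set a : ℂ := x / R with ha
      have ha1 : ‖a‖ = 1 := by
        rw [ha, norm_div, heq, Complex.norm_real, Real.norm_of_nonneg hR.le, div_self hR.ne']
      have hxa : x = a * R := by rw [ha]; field_simp
      obtain ⟨K, hKU, hK, hfr⟩ := hnd a ha1
      obtain ⟨q, hqK, hq⟩ := hK.exists_mapClusterPt_of_frequently hfr
      obtain ⟨r, hr, N, hN, hext⟩ := exists_ext U hop u hpos hh q (hKU hqK)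
      have hfr2 : ∃ᶠ s : ℝ in 𝓝[<] R, P (a * s) ∈ N := hq.frequently hN
      have hev : ∀ᶠ s : ℝ in 𝓝[<] R, s ∈ Ioo (max 0 (R - r)) R :=
        Ioo_mem_nhdsLT (max_lt hR (by linarith))
      obtain ⟨s, hsN, hs1, hs2⟩ := (hfr2.and_eventually hev).exists
      have hs0 : 0 < s := (le_max_left _ _).trans_lt hs1
      have hsr : R - r < s := (le_max_right _ _).trans_lt hs1
      have hsb : a * (s : ℂ) ∈ ball (0 : ℂ) R := by
        simp [ha1, abs_of_pos hs0, hs2]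
      obtain ⟨g, hg, hgP, -⟩ := hext P (a * s)
        (by filter_upwards [isOpen_ball.mem_nhds hsb] with z hz using hP z hz) hsN
      refine ⟨ball (a * s) r, g, isOpen_ball, ?_, convex_ball _ _, hg, ?_⟩
      · rw [mem_ball_iff_norm, hxa, ← mul_sub, norm_mul, ha1, one_mul, ← Complex.ofReal_sub,
          Complex.norm_real, Real.norm_of_nonneg (by linarith)]
        linarith
      · exact iso_eqOn (isOpen_ball.inter isOpen_ball)
          ((convex_ball _ _).inter (convex_ball _ _)).isPreconnected
          (fun z hz => hg z hz.1) (fun z hz => hP z hz.2) ⟨mem_ball_self hr, hsb⟩ hgP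
  choose! S G hSo hxS hSc hGi hGP using hloc
  obtain ⟨δ, hδ, hleb⟩ := lebesgue_number_lemma_of_metric (s := closedBall (0 : ℂ) R)
    (ι := closedBall (0 : ℂ) R) (c := fun x => S x) (isCompact_closedBall _ _)
    (fun x => hSo x x.2) (fun x hx => mem_iUnion.2 ⟨⟨x, hx⟩, hxS x hx⟩)
  -- uniform extensions
  have huni : ∀ x : ℂ, x ∈ closedBall (0 : ℂ) R → ∃ g : ℂ → ℂ,
      (∀ z ∈ ball x δ, IsoAt U u g z) ∧ EqOn g P (ball x δ ∩ ball 0 R) := by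
    intro x hx
    obtain ⟨y, hy⟩ := hleb x hx
    exact ⟨G y, fun z hz => hGi y y.2 z (hy hz),
      fun z hz => hGP y y.2 ⟨hy hz.1, hz.2⟩⟩
  choose! F hF hFP using huni
  set t : ℝ := R / (R + δ) with ht
  have ht0 : 0 < t := by positivity
  have htR : t * (R + δ) = R := by rw [ht]; field_simp
  have htin : ∀ z ∈ ball (0 : ℂ) (R + δ), (t : ℂ) * z ∈ ball (0 : ℂ) R := by
    intro z hz
    have hz' : ‖z‖ < R + δ := by simpa using hz
    have : t * ‖z‖ < R := by rw [← htR]; exact mul_lt_mul_of_pos_left hz' ht0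
    simpa [abs_of_pos ht0] using this
  have htd : ∀ z ∈ ball (0 : ℂ) (R + δ), z ∈ ball ((t : ℂ) * z) δ := by
    intro z hz
    have hz' : ‖z‖ < R + δ := by simpa using hz
    have h1 : z - t * z = ((1 - t : ℝ) : ℂ) * z := by push_cast; ring
    have h2 : (1 - t) * (R + δ) = δ := by rw [sub_mul, htR]; ring
    have h3 : 0 < 1 - t := by
      by_contra h; nlinarith
    rw [mem_ball_iff_norm, h1, norm_mul, Complex.norm_real, Real.norm_of_nonneg h3.le]
    calc (1 - t) * ‖z‖ < (1 - t) * (R + δ) := mul_lt_mul_of_pos_left hz' h3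
      _ = δ := h2
  have hcl : ∀ z ∈ ball (0 : ℂ) (R + δ), (t : ℂ) * z ∈ closedBall (0 : ℂ) R :=
    fun z hz => ball_subset_closedBall (htin z hz)
  have hgerm : ∀ z₁ ∈ ball (0 : ℂ) (R + δ),
      (fun z => F (t * z) z) =ᶠ[𝓝 z₁] F (t * z₁) := by
    intro z₁ hz₁
    have hct : Continuous (fun z : ℂ => (t : ℂ) * z) := by fun_prop
    have e1 : ∀ᶠ z in 𝓝 z₁, (t : ℂ) * z ∈ ball ((t : ℂ) * z₁) δ :=
      hct.continuousAt.eventually (ball_mem_nhds _ hδ)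
    filter_upwards [e1, isOpen_ball.mem_nhds hz₁, isOpen_ball.mem_nhds (htd z₁ hz₁)]
      with z h1 h2 h3
    have hmem : (t : ℂ) * z₁ ∈ ball ((t : ℂ) * z) δ ∩ ball ((t : ℂ) * z₁) δ :=
      ⟨mem_ball_comm.1 h1, mem_ball_self hδ⟩
    refine iso_eqOn (isOpen_ball.inter isOpen_ball)
      ((convex_ball ((t : ℂ) * z) δ).inter (convex_ball ((t : ℂ) * z₁) δ)).isPreconnected
      (fun w hw => hF _ (hcl z h2) w hw.1) (fun w hw => hF _ (hcl z₁ hz₁) w hw.2)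
      hmem ?_ ⟨htd z h2, h3⟩
    filter_upwards [(isOpen_ball.inter isOpen_ball).mem_nhds hmem,
      isOpen_ball.mem_nhds (htin z₁ hz₁)] with w hw hwR
    rw [hFP _ (hcl z h2) ⟨hw.1, hwR⟩, hFP _ (hcl z₁ hz₁) ⟨hw.2, hwR⟩]
  refine ⟨R + δ, by linarith, fun z => F (t * z) z, ?_, ?_⟩
  · intro z hz
    exact (hF _ (hcl z hz) z (htd z hz)).congr (hgerm z hz)
  · have h0 : (0 : ℂ) ∈ ball (0 : ℂ) (R + δ) := mem_ball_self (by positivity)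
    refine (hgerm 0 h0).trans ?_
    filter_upwards [isOpen_ball.mem_nhds (htd 0 h0), ball_mem_nhds (0 : ℂ) hR] with w h1 h2
    exact hFP _ (hcl 0 h0) ⟨h1, h2⟩

/-- **Fujimoto's lemma on flat conformal metrics** (Corollary 1.6.7 of
Fujimoto's book).  Let `dσ² = u(z)|dz|²` be a flat conformal metric (`u`
smooth and positive with `log u` harmonic) on a nonempty open connected set
`U ⊆ ℂ`.  For each `p ∈ U` there are `R ∈ (0, ∞]`, a holomorphic local
isometry `Φ : Δ_R → U` from the Euclidean disk `Δ_R` onto an open neighborhood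
of `p` with `Φ(0) = p` and `|Φ'|²·(u ∘ Φ) ≡ 1`, and a unit complex number `a₀`
such that the `Φ`-image of the radius `s ↦ a₀·s`, `0 ≤ s < R`, is divergent
in `U`. -/
theorem flat_metric_local_isometry
    (U : Set ℂ) (hop : IsOpen U) (hconn : IsConnected U)
    (u : ℂ → ℝ) (hpos : ∀ z ∈ U, 0 < u z) (hsm : ContDiffOn ℝ ((⊤ : ℕ∞) : WithTop ℕ∞) u U)
    (hflat : HarmonicOnC (fun z => Real.log (u z)) U)
    (p : ℂ) (hp : p ∈ U) :
    ∃ (R : ℝ≥0∞) (Φ : ℂ → ℂ) (a₀ : ℂ), 0 < R ∧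
      DifferentiableOn ℂ Φ (EMetric.ball 0 R) ∧
      Φ 0 = p ∧
      (∀ z ∈ EMetric.ball (0 : ℂ) R, Φ z ∈ U) ∧
      (∀ z ∈ EMetric.ball (0 : ℂ) R, ‖deriv Φ z‖ ^ 2 * u (Φ z) = 1) ∧
      ‖a₀‖ = 1 ∧
      ∀ K : Set ℂ, K ⊆ U → IsCompact K →
        ∃ s₀ : ℝ, 0 ≤ s₀ ∧ ENNReal.ofReal s₀ < R ∧
          ∀ s : ℝ, s₀ < s → ENNReal.ofReal s < R → Φ (a₀ * s) ∉ K := by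
  have hh := harmonic_bridge U hop u hpos hsm hflat
  obtain ⟨f₀, r₀, hr₀, hf₀p, hf₀⟩ := exists_normal U hop u hpos hh p hp
  set S : Set ℝ := {r | 0 < r ∧ ∃ f : ℂ → ℂ, (∀ z ∈ ball (0 : ℂ) r, IsoAt U u f z) ∧
    f =ᶠ[𝓝 0] f₀} with hS
  have hr₀S : r₀ ∈ S := ⟨hr₀, f₀, hf₀, EventuallyEq.rfl⟩
  have hS' : ∀ r ∈ S, ∃ f : ℂ → ℂ, (∀ z ∈ ball (0 : ℂ) r, IsoAt U u f z) ∧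
    f =ᶠ[𝓝 0] f₀ := fun r hr => hr.2
  choose! f hf hff using hS'
  have hcompat : ∀ r ∈ S, ∀ r' ∈ S, ∀ z : ℂ, ‖z‖ < r → ‖z‖ < r' → f r z = f r' z := by
    intro r hr r' hr' z hz hz'
    exact iso_eqOn (isOpen_ball.inter isOpen_ball)
      ((convex_ball (0 : ℂ) r).inter (convex_ball (0 : ℂ) r')).isPreconnected
      (fun w hw => hf r hr w hw.1) (fun w hw => hf r' hr' w hw.2)
      ⟨mem_ball_self hr.1, mem_ball_self hr'.1⟩ ((hff r hr).trans (hff r' hr').symm)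
      ⟨by simpa using hz, by simpa using hz'⟩
  have hρ : ∀ z : ℂ, (∃ r ∈ S, ‖z‖ < r) → ∃ r, r ∈ S ∧ ‖z‖ < r := fun z h => h
  choose! ρ hρS hρz using hρ
  set P : ℂ → ℂ := fun z => f (ρ z) z with hPdef
  have hPeq : ∀ r ∈ S, EqOn P (f r) (ball 0 r) := by
    intro r hr z hz
    have hz' : ‖z‖ < r := by simpa using hz
    exact hcompat _ (hρS z ⟨r, hr, hz'⟩) r hr z (hρz z ⟨r, hr, hz'⟩) hz'
  have hPiso : ∀ r ∈ S, ∀ z ∈ ball (0 : ℂ) r, IsoAt U u P z := by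
    intro r hr z hz
    refine (hf r hr z hz).congr ?_
    filter_upwards [isOpen_ball.mem_nhds hz] with w hw using hPeq r hr hw
  have hP0 : P =ᶠ[𝓝 0] f₀ := by
    refine EventuallyEq.trans ?_ (hff r₀ hr₀S)
    filter_upwards [ball_mem_nhds (0 : ℂ) hr₀] with w hw using hPeq r₀ hr₀S hw
  have hPp : P 0 = p := hP0.eq_of_nhds.trans hf₀p
  by_cases hbdd : BddAbove S
  · set R := sSup S with hRdef
    have hRle : ∀ r ∈ S, r ≤ R := fun r hr => le_csSup hbdd hr
    have hR : 0 < R := hr₀.trans_le (hRle r₀ hr₀S)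
    have hPR : ∀ z ∈ ball (0 : ℂ) R, IsoAt U u P z := by
      intro z hz
      obtain ⟨r, hr, hzr⟩ := exists_lt_of_lt_csSup ⟨r₀, hr₀S⟩ (show ‖z‖ < sSup S by simpa using hz)
      exact hPiso r hr z (by simpa using hzr)
    have hball : EMetric.ball (0 : ℂ) (ENNReal.ofReal R) = ball 0 R := Metric.eball_ofReal
    have hex : ∃ a : ℂ, ‖a‖ = 1 ∧ ∀ K ⊆ U, IsCompact K →
        ¬ ∃ᶠ s : ℝ in 𝓝[<] R, P (a * s) ∈ K := by
      by_contra hcon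
      push Not at hcon
      obtain ⟨R', hRR', g, hg, hgP⟩ := disc_case U hop u hpos hh R hR P hPR (by
        intro a ha
        obtain ⟨K, h1, h2, h3⟩ := hcon a ha
        exact ⟨K, h1, h2, h3⟩)
      exact absurd (hRle R' ⟨hR.trans hRR', g, hg, hgP.trans hP0⟩) (not_le.2 hRR')
    obtain ⟨a, ha, haK⟩ := hex
    refine ⟨ENNReal.ofReal R, P, a, by simpa using hR, ?_, hPp, ?_, ?_, ha, ?_⟩
    · rw [hball]
      exact fun z hz => (hPR z hz).1.differentiableWithinAt
    · rw [hball]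
      exact fun z hz => (hPR z hz).2.1
    · rw [hball]
      exact fun z hz => (hPR z hz).2.2
    · intro K hKU hK
      have h1 := not_frequently.1 (haK K hKU hK)
      obtain ⟨l, hl, hlK⟩ := (mem_nhdsLT_iff_exists_Ioo_subset' hR).1 h1
      refine ⟨max l 0, le_max_right _ _, ?_, ?_⟩
      · rw [ENNReal.ofReal_lt_ofReal_iff hR]
        exact max_lt hl hR
      · intro s hs hsR
        rw [ENNReal.ofReal_lt_ofReal_iff hR] at hsR
        exact hlK ⟨(le_max_left _ _).trans_lt hs, hsR⟩
  · have hPall : ∀ z, IsoAt U u P z := by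
      intro z
      obtain ⟨r, hr, hzr⟩ := not_bddAbove_iff.1 hbdd ‖z‖
      exact hPiso r hr z (by simpa using hzr)
    obtain ⟨a, ha, haK⟩ := entire_case U hop u hpos hh P hPall
    refine ⟨⊤, P, a, by simp, fun z _ => (hPall z).1.differentiableWithinAt, hPp,
      fun z _ => (hPall z).2.1, fun z _ => (hPall z).2.2, ha, ?_⟩
    intro K hKU hK
    obtain ⟨s₀, h0, hs⟩ := haK K hKU hK
    exact ⟨s₀, h0, by simp, fun s h _ => hs s h⟩
end

section
/- Let Ω ⊆ ℂ be a nonempty open simply connected set and let h, g : Ω → ℂ be holomorphic functions with no common zero such that the conformal metric (|h(z)|² + |g(z)|²)|dz|² on Ω is complete. If |g(z)| ≠ |h(z)| for every z ∈ Ω (equivalently, the meromorphic function ρ = g/h omits every value on the unit circle {w ∈ ℂ : |w| = 1}), then ρ is constant, i.e. there exist (a, b) ∈ ℂ² ∖ {(0,0)} with a·g + b·h ≡ 0 on Ω. (This is the analytic core of the classification of complete nonsingular flat surfaces in H³: a point p of a flat front is singular if and only if |ρ(p)| = 1, so a nonsingular weakly complete flat front has ρ omitting the unit circle, hence ρ is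 constant and the surface is a horosphere or a hyperbolic cylinder.) -/
open MeasureTheory

/-- A path `γ : [0,1) → ℂ` is *divergent* in an open set `U ⊆ ℂ`: it eventually
leaves every compact subset of `U`. -/
def DivergentPath (U : Set ℂ) (γ : ℝ → ℂ) : Prop :=
  ∀ K : Set ℂ, K ⊆ U → IsCompact K →
    ∃ t₀ ∈ Set.Ico (0 : ℝ) 1, ∀ t, t₀ < t → t < 1 → γ t ∉ K

/-- `γ : [0,1) → ℂ` is continuous and piecewise continuously differentiable,
with derivative `γ'` away from a locally finite set of exceptional points. -/
def PiecewiseC1 (γ γ' : ℝ → ℂ) : Prop :=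
  ContinuousOn γ (Set.Ico 0 1) ∧
  ∃ D : Set ℝ, (∀ b : ℝ, b < 1 → (D ∩ Set.Icc 0 b).Finite) ∧
    (∀ t ∈ Set.Ico (0 : ℝ) 1 \ D, HasDerivAt γ (γ' t) t) ∧
    ContinuousOn γ' (Set.Ico 0 1 \ D)

/-- The conformal metric `lam(z)² |dz|²` on `U` is *complete*: every divergent
piecewise C¹ path in `U` has infinite length. -/
def MetricComplete (U : Set ℂ) (lam : ℂ → ℝ) : Prop :=
  ∀ γ γ' : ℝ → ℂ, (∀ t ∈ Set.Ico (0 : ℝ) 1, γ t ∈ U) →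
    PiecewiseC1 γ γ' → DivergentPath U γ →
    ∫⁻ t in Set.Ico (0 : ℝ) 1, ENNReal.ofReal (lam (γ t) * ‖γ' t‖) = ⊤

open Set Filter Topology Metric

/-- `f` solves `f' = 1 / h(f)` on `U` with values in `Ω`. -/
def FlatSol (Ω : Set ℂ) (h : ℂ → ℂ) (U : Set ℂ) (f : ℂ → ℂ) : Prop :=
  ∀ p ∈ U, f p ∈ Ω ∧ HasDerivAt f (h (f p))⁻¹ p

lemma FlatSol.mono {Ω : Set ℂ} {h : ℂ → ℂ} {U V : Set ℂ} {f : ℂ → ℂ}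
    (hf : FlatSol Ω h U f) (hVU : V ⊆ U) : FlatSol Ω h V f := fun p hp => hf p (hVU hp)

lemma FlatSol.analytic {Ω : Set ℂ} {h : ℂ → ℂ} {U : Set ℂ} {f : ℂ → ℂ}
    (hf : FlatSol Ω h U f) (hU : IsOpen U) : AnalyticOnNhd ℂ f U := by
  apply DifferentiableOn.analyticOnNhd _ hU
  intro p hp
  exact (hf p hp).2.differentiableAt.differentiableWithinAt

/-- A local primitive of `h`, packaged as a local homeomorphism. -/
lemma exists_local_primitive {Ω : Set ℂ} (hop : IsOpen Ω) {h : ℂ → ℂ}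
    (hh : DifferentiableOn ℂ h Ω) (h0 : ∀ z ∈ Ω, h z ≠ 0) {z : ℂ} (hz : z ∈ Ω) :
    ∃ e : OpenPartialHomeomorph ℂ ℂ, z ∈ e.source ∧ e.source ⊆ Ω ∧
      ∀ x ∈ e.source, HasDerivAt e (h x) x := by
  obtain ⟨r, hr, hrΩ⟩ := Metric.isOpen_iff.mp hop z hz
  obtain ⟨F, hF⟩ := (hh.mono hrΩ).isExactOn_ball
  have hzb : z ∈ ball z r := mem_ball_self hr
  have hFa : AnalyticAt ℂ F z :=
    DifferentiableOn.analyticAt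
      (fun x hx => (hF x hx).differentiableAt.differentiableWithinAt) (ball_mem_nhds z hr)
  have hs : HasStrictDerivAt F (h z) z := by
    have := hFa.hasStrictDerivAt
    rwa [(hF z hzb).deriv] at this
  have hs' := hs.hasStrictFDerivAt_equiv (h0 z hz)
  refine ⟨hs'.toOpenPartialHomeomorph.restrOpen (ball z r) isOpen_ball, ?_, ?_, ?_⟩
  · exact ⟨hs'.mem_toOpenPartialHomeomorph_source, hzb⟩
  · intro x hx
    exact hrΩ hx.2
  · intro x hx
    exact hF x hx.2

lemma local_exist {Ω : Set ℂ} (hop : IsOpen Ω) {h : ℂ → ℂ}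
    (hh : DifferentiableOn ℂ h Ω) (h0 : ∀ z ∈ Ω, h z ≠ 0) {z₁ : ℂ} (hz : z₁ ∈ Ω) :
    ∃ δ > 0, ∀ᶠ z in 𝓝 z₁, ∀ c, ∃ f, FlatSol Ω h (ball c δ) f ∧ f c = z := by
  obtain ⟨e, hze, hsub, hder⟩ := exists_local_primitive hop hh h0 hz
  obtain ⟨ε, hε, hεt⟩ := Metric.isOpen_iff.mp e.open_target (e z₁) (e.map_source hze)
  refine ⟨ε / 2, by positivity, ?_⟩
  have hcont : ContinuousAt e z₁ := e.continuousAt hze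
  filter_upwards [e.open_source.mem_nhds hze,
    hcont.preimage_mem_nhds (ball_mem_nhds _ (half_pos hε))] with z hzs hzb c
  refine ⟨fun p => e.symm (e z + (p - c)), ?_, ?_⟩
  · intro p hp
    have ht : e z + (p - c) ∈ e.target := by
      apply hεt
      have h1 : dist (e z) (e z₁) < ε / 2 := hzb
      have h2 : dist p c < ε / 2 := hp
      rw [dist_eq_norm] at h1 h2
      rw [mem_ball, dist_eq_norm]
      have : e z + (p - c) - e z₁ = (e z - e z₁) + (p - c) := by ring
      rw [this]
      linarith [norm_add_le (e z - e z₁) (p - c)]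
    have hsrc := e.map_target ht
    refine ⟨hsub hsrc, ?_⟩
    have h1 := e.hasDerivAt_symm ht (h0 _ (hsub hsrc)) (hder _ hsrc)
    have h2 : HasDerivAt (fun p => e z + (p - c)) 1 p :=
      ((hasDerivAt_id p).sub_const c).const_add (e z)
    have h3 := h1.comp p h2
    rw [mul_one] at h3
    exact h3
  · simp [e.left_inv hzs]

lemma sol_unique {Ω : Set ℂ} (hop : IsOpen Ω) {h : ℂ → ℂ}
    (hh : DifferentiableOn ℂ h Ω) (h0 : ∀ z ∈ Ω, h z ≠ 0) {U : Set ℂ} (hU : IsOpen U)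
    (hUc : IsPreconnected U) {f₁ f₂ : ℂ → ℂ} (hf₁ : FlatSol Ω h U f₁) (hf₂ : FlatSol Ω h U f₂)
    {p₀ : ℂ} (hp₀ : p₀ ∈ U) (heq : f₁ p₀ = f₂ p₀) : EqOn f₁ f₂ U := by
  apply (hf₁.analytic hU).eqOn_of_preconnected_of_eventuallyEq (hf₂.analytic hU) hUc hp₀
  obtain ⟨e, hze, hsub, hder⟩ := exists_local_primitive hop hh h0 (hf₁ p₀ hp₀).1
  have hc1 := (hf₁ p₀ hp₀).2.continuousAt
  have hc2 := (hf₂ p₀ hp₀).2.continuousAt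
  have hev : ∀ᶠ p in 𝓝 p₀, p ∈ U ∧ f₁ p ∈ e.source ∧ f₂ p ∈ e.source := by
    filter_upwards [hU.mem_nhds hp₀, hc1.preimage_mem_nhds (e.open_source.mem_nhds hze),
      hc2.preimage_mem_nhds (e.open_source.mem_nhds (heq ▸ hze))] with p h1 h2 h3
    exact ⟨h1, h2, h3⟩
  obtain ⟨r, hr, hb⟩ := Metric.eventually_nhds_iff_ball.mp hev
  have hd : ∀ p ∈ ball p₀ r, HasDerivAt (fun p => e (f₁ p) - e (f₂ p)) 0 p := by
    intro p hp
    obtain ⟨h1, h2, h3⟩ := hb p hp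
    have a1 := (hder _ h2).comp p (hf₁ p h1).2
    have a2 := (hder _ h3).comp p (hf₂ p h1).2
    have a3 := a1.sub a2
    rw [mul_inv_cancel₀ (h0 _ (hsub h2)), mul_inv_cancel₀ (h0 _ (hsub h3)), sub_self] at a3
    exact a3
  have hconst : ∀ p ∈ ball p₀ r, e (f₁ p) - e (f₂ p) = e (f₁ p₀) - e (f₂ p₀) := by
    intro p hp
    exact (isOpen_ball).is_const_of_deriv_eq_zero (convex_ball p₀ r).isPreconnected
      (fun x hx => (hd x hx).differentiableAt.differentiableWithinAt)
      (fun x hx => (hd x hx).deriv) hp (mem_ball_self hr)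
  filter_upwards [ball_mem_nhds p₀ hr] with p hp
  obtain ⟨h1, h2, h3⟩ := hb p hp
  have := hconst p hp
  rw [heq, sub_self, sub_eq_zero] at this
  exact e.injOn h2 h3 this

lemma sol_glue {Ω : Set ℂ} {h : ℂ → ℂ} {ι : Type*} (U : ι → Set ℂ) (F : ι → ℂ → ℂ)
    (hU : ∀ i, IsOpen (U i)) (hF : ∀ i, FlatSol Ω h (U i) (F i))
    (hag : ∀ i j p, p ∈ U i → p ∈ U j → F i p = F j p) :
    ∃ f, FlatSol Ω h (⋃ i, U i) f ∧ ∀ i, EqOn f (F i) (U i) := by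
  classical
  let f : ℂ → ℂ := fun p => if hp : ∃ i, p ∈ U i then F hp.choose p else 0
  have hfe : ∀ i, EqOn f (F i) (U i) := by
    intro i p hp
    have hex : ∃ i, p ∈ U i := ⟨i, hp⟩
    simp only [f, dif_pos hex]
    exact hag _ _ p hex.choose_spec hp
  refine ⟨f, ?_, hfe⟩
  intro p hp
  obtain ⟨i, hi⟩ := mem_iUnion.mp hp
  obtain ⟨a, b⟩ := hF i p hi
  rw [hfe i hi]
  refine ⟨a, b.congr_of_eventuallyEq ?_⟩
  filter_upwards [(hU i).mem_nhds hi] with q hq using hfe i hq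

lemma closer_aux (p c : ℂ) (l : ℝ) (hl0 : 0 ≤ l) (hl1 : l ≤ 1) (hc : ‖c‖ ≤ l * ‖p‖) :
    ‖l • p - c‖ ≤ ‖p - c‖ := by
  have h1 := norm_sub_sq_real (l • p) c
  have h2 := norm_sub_sq_real p c
  rw [norm_smul, Real.norm_of_nonneg hl0, real_inner_smul_left] at h1
  have h3 := real_inner_le_norm p c
  have hp := norm_nonneg p
  have h4 : (inner ℝ p c : ℝ) ≤ l * ‖p‖ ^ 2 := by nlinarith
  have h5 : l * ‖p‖ ^ 2 ≤ ‖p‖ ^ 2 := by nlinarith [sq_nonneg ‖p‖]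
  apply le_of_sq_le_sq _ (norm_nonneg _)
  nlinarith [mul_nonneg (sub_nonneg.2 hl1) (sub_nonneg.2 h4),
    mul_nonneg (sub_nonneg.2 hl1) (sub_nonneg.2 h5)]

/-- Extension of a solution beyond a disc. -/
lemma sol_extend {Ω : Set ℂ} (hop : IsOpen Ω) {h : ℂ → ℂ}
    (hh : DifferentiableOn ℂ h Ω) (h0 : ∀ z ∈ Ω, h z ≠ 0) {R : ℝ} (hR : 0 < R) {G : ℂ → ℂ}
    (hG : FlatSol Ω h (ball 0 R) G)
    (hloc : ∀ w, ‖w‖ = R → ∃ c ∈ ball (0 : ℂ) R, ∃ δ, w ∈ ball c δ ∧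
      ∃ f, FlatSol Ω h (ball c δ) f ∧ f c = G c) :
    ∃ R' > R, ∃ f, FlatSol Ω h (ball 0 R') f ∧ f 0 = G 0 := by
  let ι := {x : ℂ × ℝ × (ℂ → ℂ) // x.1 ∈ ball (0 : ℂ) R ∧ 0 < x.2.1 ∧
    FlatSol Ω h (ball x.1 x.2.1) x.2.2 ∧ x.2.2 x.1 = G x.1}
  have key : ∀ i : ι, ∀ p, p ∈ ball i.1.1 i.1.2.1 → p ∈ ball (0 : ℂ) R → i.1.2.2 p = G p := by
    rintro ⟨⟨c, r, f⟩, hc, hr, hf, hfc⟩ p hp hp0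
    exact sol_unique hop hh h0 (isOpen_ball.inter isOpen_ball)
      ((convex_ball c r).inter (convex_ball (0 : ℂ) R)).isPreconnected
      (hf.mono inter_subset_left) (hG.mono inter_subset_right)
      ⟨mem_ball_self hr, hc⟩ hfc ⟨hp, hp0⟩
  obtain ⟨f, hf, hfe⟩ := sol_glue (Ω := Ω) (h := h) (fun i : ι => ball i.1.1 i.1.2.1)
    (fun i => i.1.2.2) (fun i => isOpen_ball) (fun i => i.2.2.2.1) (by
      intro i j p hpi hpj
      by_cases hp0 : p ∈ ball (0 : ℂ) R
      · rw [key i p hpi hp0, key j p hpj hp0]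
      have hpR : R ≤ ‖p‖ := by simpa using hp0
      have hpp : 0 < ‖p‖ := hR.trans_le hpR
      have hci : ‖i.1.1‖ < R := by simpa using i.2.1
      have hcj : ‖j.1.1‖ < R := by simpa using j.2.1
      set s := max ‖i.1.1‖ ‖j.1.1‖ with hs
      have hsR : s < R := max_lt hci hcj
      have hs0 : 0 ≤ s := (norm_nonneg _).trans (le_max_left _ _)
      set l := s / ‖p‖ with hl
      have hl0 : 0 ≤ l := by positivity
      have hl1 : l ≤ 1 := (div_le_one hpp).2 (by linarith)
      have hlp : l * ‖p‖ = s := div_mul_cancel₀ _ hpp.ne'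
      have q0 : l • p ∈ ball (0 : ℂ) R := by
        rw [mem_ball_zero_iff, norm_smul, Real.norm_of_nonneg hl0, hlp]; exact hsR
      have qi : l • p ∈ ball i.1.1 i.1.2.1 := by
        rw [mem_ball, dist_eq_norm] at hpi ⊢
        exact (closer_aux _ _ l hl0 hl1 (hlp ▸ le_max_left _ _)).trans_lt hpi
      have qj : l • p ∈ ball j.1.1 j.1.2.1 := by
        rw [mem_ball, dist_eq_norm] at hpj ⊢
        exact (closer_aux _ _ l hl0 hl1 (hlp ▸ le_max_right _ _)).trans_lt hpj
      exact sol_unique hop hh h0 (isOpen_ball.inter isOpen_ball)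
        ((convex_ball i.1.1 i.1.2.1).inter (convex_ball j.1.1 j.1.2.1)).isPreconnected
        (i.2.2.2.1.mono inter_subset_left) (j.2.2.2.1.mono inter_subset_right)
        ⟨qi, qj⟩ ((key i _ qi q0).trans (key j _ qj q0).symm) ⟨hpi, hpj⟩)
  let i₀ : ι := ⟨(0, R, G), mem_ball_self hR, hR, hG, rfl⟩
  have hVo : IsOpen (⋃ i : ι, ball i.1.1 i.1.2.1) := isOpen_iUnion fun i => isOpen_ball
  have hsub : closedBall (0 : ℂ) R ⊆ ⋃ i : ι, ball i.1.1 i.1.2.1 := by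
    intro w hw
    rw [mem_closedBall_zero_iff] at hw
    rcases hw.lt_or_eq with hw | hw
    · exact mem_iUnion.2 ⟨i₀, by simpa [i₀] using hw⟩
    · obtain ⟨c, hc, δ, hwc, f, hf, hfc⟩ := hloc w hw
      exact mem_iUnion.2 ⟨⟨(c, δ, f), hc, pos_of_mem_ball hwc, hf, hfc⟩, hwc⟩
  obtain ⟨ε, hε, hεV⟩ := (isCompact_closedBall (0 : ℂ) R).exists_thickening_subset_open hVo hsub
  rw [thickening_closedBall hε hR.le] at hεV
  exact ⟨ε + R, by linarith, f, hf.mono hεV, hfe i₀ (mem_ball_self hR)⟩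

/-- Completeness forces local extendability at boundary points. -/
lemma sol_loc {Ω : Set ℂ} (hop : IsOpen Ω) {h g : ℂ → ℂ}
    (hh : DifferentiableOn ℂ h Ω) (h0 : ∀ z ∈ Ω, h z ≠ 0)
    (hgh : ∀ z ∈ Ω, ‖g z‖ < ‖h z‖)
    (hcomplete : MetricComplete Ω (fun z => Real.sqrt (‖h z‖ ^ 2 + ‖g z‖ ^ 2)))
    {R : ℝ} (hR : 0 < R) {G : ℂ → ℂ} (hG : FlatSol Ω h (ball 0 R) G) (w : ℂ) (hw : ‖w‖ = R) :
    ∃ c ∈ ball (0 : ℂ) R, ∃ δ, w ∈ ball c δ ∧ ∃ f, FlatSol Ω h (ball c δ) f ∧ f c = G c := by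
  have hmem : ∀ t ∈ Ico (0 : ℝ) 1, (t : ℂ) * w ∈ ball (0 : ℂ) R := by
    intro t ht
    rw [mem_ball_zero_iff, norm_mul, Complex.norm_real, Real.norm_of_nonneg ht.1, hw]
    nlinarith [ht.2]
  have hder : ∀ t ∈ Ico (0 : ℝ) 1, HasDerivAt (fun t : ℝ => G ((t : ℂ) * w))
      ((h (G ((t : ℂ) * w)))⁻¹ * w) t := by
    intro t ht
    have h1 : HasDerivAt (fun t : ℝ => (t : ℂ) * w) w t := by
      simpa using (Complex.ofRealCLM.hasDerivAt (x := t)).mul_const w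
    exact (hG _ (hmem t ht)).2.comp t h1
  have hcont : ContinuousOn (fun t : ℝ => G ((t : ℂ) * w)) (Ico 0 1) :=
    fun t ht => (hder t ht).continuousAt.continuousWithinAt
  have hnd : ¬ DivergentPath Ω (fun t : ℝ => G ((t : ℂ) * w)) := by
    intro hd
    have htop := hcomplete _ (fun t : ℝ => (h (G ((t : ℂ) * w)))⁻¹ * w)
      (fun t ht => (hG _ (hmem t ht)).1)
      ⟨hcont, ∅, by simp, by simpa using fun t h1 h2 => hder t ⟨h1, h2⟩, by
        rw [sdiff_empty]
        exact ((hh.continuousOn.comp hcont (fun t ht => (hG _ (hmem t ht)).1)).inv₀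
          (fun t ht => h0 _ (hG _ (hmem t ht)).1)).mul continuousOn_const⟩ hd
    have hle : ∫⁻ t in Ico (0 : ℝ) 1, ENNReal.ofReal
        (Real.sqrt (‖h (G ((t : ℂ) * w))‖ ^ 2 + ‖g (G ((t : ℂ) * w))‖ ^ 2) *
          ‖(h (G ((t : ℂ) * w)))⁻¹ * w‖) ≤ ∫⁻ t in Ico (0 : ℝ) 1, ENNReal.ofReal (2 * R) := by
      apply setLIntegral_mono' measurableSet_Ico
      intro t ht
      apply ENNReal.ofReal_le_ofReal
      have hz := (hG _ (hmem t ht)).1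
      set z := G ((t : ℂ) * w)
      have hpos : 0 < ‖h z‖ := norm_pos_iff.2 (h0 z hz)
      have hs : Real.sqrt (‖h z‖ ^ 2 + ‖g z‖ ^ 2) ≤ 2 * ‖h z‖ := by
        apply Real.sqrt_le_iff.2 ⟨by positivity, ?_⟩
        nlinarith [hgh z hz, norm_nonneg (g z)]
      rw [norm_mul, norm_inv, hw]
      calc _ ≤ 2 * ‖h z‖ * (‖h z‖⁻¹ * R) := by gcongr
        _ = 2 * R := by field_simp
    rw [show (∫⁻ t in Ico (0 : ℝ) 1, ENNReal.ofReal
        (Real.sqrt (‖h (G ((t : ℂ) * w))‖ ^ 2 + ‖g (G ((t : ℂ) * w))‖ ^ 2) *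
          ‖(h (G ((t : ℂ) * w)))⁻¹ * w‖)) = ⊤ from htop] at hle
    rw [setLIntegral_const, Real.volume_Ico] at hle
    exact absurd (top_le_iff.1 hle) (ENNReal.mul_ne_top ENNReal.ofReal_ne_top ENNReal.ofReal_ne_top)
  unfold DivergentPath at hnd
  push Not at hnd
  obtain ⟨K, hKΩ, hK, hfr⟩ := hnd
  have hfreq : ∃ᶠ t : ℝ in 𝓝[<] (1 : ℝ), G ((t : ℂ) * w) ∈ K := by
    intro hev
    obtain ⟨a, ha, hsub⟩ := (mem_nhdsLT_iff_exists_Ioo_subset (a := (1 : ℝ))).1 hev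
    obtain ⟨t, h1, h2, h3⟩ := hfr (max a 0) ⟨le_max_right _ _, max_lt ha one_pos⟩
    exact hsub ⟨(le_max_left _ _).trans_lt h1, h2⟩ h3
  obtain ⟨z₁, hz₁, hcl⟩ := hK.exists_mapClusterPt_of_frequently hfreq
  obtain ⟨δ, hδ, hev⟩ := local_exist hop hh h0 (hKΩ hz₁)
  have hfr2 : ∃ᶠ t : ℝ in 𝓝[<] (1 : ℝ), ∀ c, ∃ f, FlatSol Ω h (ball c δ) f ∧
      f c = G ((t : ℂ) * w) := hcl.frequently hev
  have hnear : ∀ᶠ t : ℝ in 𝓝[<] (1 : ℝ), t ∈ Ioo (max 0 (1 - δ / R)) 1 :=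
    Ioo_mem_nhdsLT (max_lt one_pos (by linarith [div_pos hδ hR]))
  obtain ⟨t, hft, ht⟩ := (hfr2.and_eventually hnear).exists
  have ht0 : t ∈ Ico (0 : ℝ) 1 := ⟨((le_max_left _ _).trans_lt ht.1).le, ht.2⟩
  refine ⟨(t : ℂ) * w, hmem t ht0, δ, ?_, hft _⟩
  have h1 : 1 - δ / R < t := (le_max_right _ _).trans_lt ht.1
  rw [mem_ball, dist_eq_norm, show w - (t : ℂ) * w = ((1 - t : ℝ) : ℂ) * w by push_cast; ring,
    norm_mul, Complex.norm_real, hw, Real.norm_of_nonneg (by linarith [ht.2])]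
  have : 1 - t < δ / R := by linarith
  exact (lt_div_iff₀ hR).1 this

lemma sol_entire {Ω : Set ℂ} (hop : IsOpen Ω) {h g : ℂ → ℂ}
    (hh : DifferentiableOn ℂ h Ω) (h0 : ∀ z ∈ Ω, h z ≠ 0)
    (hgh : ∀ z ∈ Ω, ‖g z‖ < ‖h z‖)
    (hcomplete : MetricComplete Ω (fun z => Real.sqrt (‖h z‖ ^ 2 + ‖g z‖ ^ 2)))
    {z₀ : ℂ} (hz₀ : z₀ ∈ Ω) : ∃ G, FlatSol Ω h univ G ∧ G 0 = z₀ := by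
  let ι := {x : ℝ × (ℂ → ℂ) // FlatSol Ω h (ball 0 x.1) x.2 ∧ x.2 0 = z₀}
  obtain ⟨G, hG, hGe⟩ := sol_glue (Ω := Ω) (h := h) (fun i : ι => ball 0 i.1.1)
    (fun i => i.1.2) (fun i => isOpen_ball) (fun i => i.2.1) (by
      intro i j p hpi hpj
      exact sol_unique hop hh h0 (isOpen_ball.inter isOpen_ball)
        ((convex_ball (0 : ℂ) i.1.1).inter (convex_ball 0 j.1.1)).isPreconnected
        (i.2.1.mono inter_subset_left) (j.2.1.mono inter_subset_right)
        ⟨mem_ball_self (pos_of_mem_ball hpi), mem_ball_self (pos_of_mem_ball hpj)⟩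
        (i.2.2.trans j.2.2.symm) ⟨hpi, hpj⟩)
  obtain ⟨δ, hδ, hev⟩ := local_exist hop hh h0 hz₀
  obtain ⟨f, hf, hf0⟩ := hev.self_of_nhds 0
  have hG0 : G 0 = z₀ := (hGe ⟨(δ, f), hf, hf0⟩ (mem_ball_self hδ)).trans hf0
  let S : Set ℝ := range (fun i : ι => i.1.1)
  have hδS : δ ∈ S := ⟨⟨(δ, f), hf, hf0⟩, rfl⟩
  by_cases hb : BddAbove S
  · exfalso
    have hR : 0 < sSup S := hδ.trans_le (le_csSup hb hδS)
    have hGR : FlatSol Ω h (ball 0 (sSup S)) G := by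
      apply hG.mono
      intro p hp
      rw [mem_ball_zero_iff] at hp
      obtain ⟨_, ⟨i, rfl⟩, hi⟩ := exists_lt_of_lt_csSup ⟨δ, hδS⟩ hp
      exact mem_iUnion.2 ⟨i, by simpa using hi⟩
    obtain ⟨R', hR', f', hf', hf0'⟩ := sol_extend hop hh h0 hR hGR
      (sol_loc hop hh h0 hgh hcomplete hR hGR)
    exact absurd (le_csSup hb ⟨⟨(R', f'), hf', hf0'.trans hG0⟩, rfl⟩) (not_le.2 hR')
  · refine ⟨G, hG.mono ?_, hG0⟩
    intro p _
    rw [not_bddAbove_iff] at hb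
    obtain ⟨_, ⟨i, rfl⟩, hi⟩ := hb ‖p‖
    exact mem_iUnion.2 ⟨i, by simpa using hi⟩

lemma flat_core {Ω : Set ℂ} (hne : Ω.Nonempty) (hop : IsOpen Ω) (hc : IsPreconnected Ω)
    {h g : ℂ → ℂ} (hh : DifferentiableOn ℂ h Ω) (hg : DifferentiableOn ℂ g Ω)
    (hgh : ∀ z ∈ Ω, ‖g z‖ < ‖h z‖)
    (hcomplete : MetricComplete Ω (fun z => Real.sqrt (‖h z‖ ^ 2 + ‖g z‖ ^ 2))) :
    ∃ c : ℂ, ∀ z ∈ Ω, g z = c * h z := by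
  have h0 : ∀ z ∈ Ω, h z ≠ 0 := fun z hz =>
    norm_pos_iff.1 ((norm_nonneg _).trans_lt (hgh z hz))
  obtain ⟨z₀, hz₀⟩ := hne
  obtain ⟨G, hG, hG0⟩ := sol_entire hop hh h0 hgh hcomplete hz₀
  have hGm : ∀ p, G p ∈ Ω := fun p => (hG p trivial).1
  have hGd : Differentiable ℂ G := fun p => (hG p trivial).2.differentiableAt
  have hρd : Differentiable ℂ (fun p => g (G p) / h (G p)) := by
    intro p
    have h1 := (hg.differentiableAt (hop.mem_nhds (hGm p))).comp p (hGd p)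
    have h2 := (hh.differentiableAt (hop.mem_nhds (hGm p))).comp p (hGd p)
    exact h1.div h2 (h0 _ (hGm p))
  have hρb : Bornology.IsBounded (range (fun p => g (G p) / h (G p))) := by
    rw [isBounded_iff_forall_norm_le]
    refine ⟨1, ?_⟩
    rintro _ ⟨p, rfl⟩
    simp only [norm_div]
    exact div_le_one_of_le₀ (hgh _ (hGm p)).le (norm_nonneg _)
  set c := g z₀ / h z₀ with hcdef
  have hconst : ∀ p, g (G p) = c * h (G p) := by
    intro p
    have := hρd.apply_eq_apply_of_bounded hρb p 0
    simp only [hG0] at this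
    rw [hcdef, ← this, div_mul_cancel₀ _ (h0 _ (hGm p))]
  refine ⟨c, ?_⟩
  have hs : HasStrictDerivAt G (h z₀)⁻¹ 0 := by
    have := (hG.analytic isOpen_univ 0 trivial).hasStrictDerivAt
    rwa [(hG 0 trivial).2.deriv, hG0] at this
  have hmap := hs.map_nhds_eq (inv_ne_zero (h0 z₀ hz₀))
  rw [hG0] at hmap
  have hev : ∀ᶠ z in 𝓝 z₀, g z = c * h z := by
    rw [← hmap, eventually_map]
    exact Eventually.of_forall hconst
  exact (hg.analyticOnNhd hop).eqOn_of_preconnected_of_eventuallyEq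
    ((hh.const_mul c).analyticOnNhd hop) hc hz₀ hev

/-- **Classification of complete nonsingular flat surfaces in `H³`** (analytic
core).  For a weakly complete flat front with canonical forms `ω = h dz`,
`θ = g dz` on the simply connected `Ω` (so `h, g` are holomorphic without
common zeros and the metric `(|h|² + |g|²)|dz|²` is complete): if
`|g(z)| ≠ |h(z)|` for all `z ∈ Ω` — i.e. the ratio `ρ = g/h` omits the whole
unit circle, which expresses that the front has no singular points — then `ρ`
is constant (and the front is a horosphere or a hyperbolic cylinder). -/
theorem nonsingular_complete_flat_is_constant_ratio
    (Ω : Set ℂ) (hne : Ω.Nonempty) (hop : IsOpen Ω) (hsc : SimplyConnectedSpace ↥Ω)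
    (h g : ℂ → ℂ) (hh : DifferentiableOn ℂ h Ω) (hg : DifferentiableOn ℂ g Ω)
    (hnocz : ∀ z ∈ Ω, h z ≠ 0 ∨ g z ≠ 0)
    (hcomplete : MetricComplete Ω (fun z => Real.sqrt (‖h z‖ ^ 2 + ‖g z‖ ^ 2)))
    (hnosing : ∀ z ∈ Ω, ‖g z‖ ≠ ‖h z‖) :
    ∃ a b : ℂ, ¬(a = 0 ∧ b = 0) ∧ ∀ z ∈ Ω, a * g z + b * h z = 0 := by
  have hc : IsPreconnected Ω := by
    have : PreconnectedSpace ↥Ω := inferInstance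
    exact isPreconnected_iff_preconnectedSpace.2 this
  have hcg : ContinuousOn (fun z => ‖g z‖) Ω := hg.continuousOn.norm
  have hch : ContinuousOn (fun z => ‖h z‖) Ω := hh.continuousOn.norm
  have hdich : (∀ z ∈ Ω, ‖g z‖ < ‖h z‖) ∨ (∀ z ∈ Ω, ‖h z‖ < ‖g z‖) := by
    by_contra hcon
    push Not at hcon
    obtain ⟨⟨x, hx, hx'⟩, ⟨y, hy, hy'⟩⟩ := hcon
    obtain ⟨z, hz, hze⟩ := hc.intermediate_value₂ hy hx hcg hch hy' hx'
    exact hnosing z hz hze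
  rcases hdich with hlt | hlt
  · obtain ⟨c, hcc⟩ := flat_core hne hop hc hh hg hlt hcomplete
    refine ⟨1, -c, by simp, fun z hz => ?_⟩
    rw [hcc z hz]; ring
  · have hcomplete' : MetricComplete Ω (fun z => Real.sqrt (‖g z‖ ^ 2 + ‖h z‖ ^ 2)) := by
      simpa only [add_comm] using hcomplete
    obtain ⟨c, hcc⟩ := flat_core hne hop hc hg hh hlt hcomplete'
    refine ⟨-c, 1, by simp, fun z hz => ?_⟩
    rw [hcc z hz]; ring
end
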